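/- arXiv:2005.12363 — 2 statements merged into one kernel-verified Lean document; each statement's English description precedes it below -/
import Mathlib

section
/- Let α be a complex number with Re(α) > 0 and Im(α) > −1. Then ∫_{−∞}^{∞} binom(iα, x) · sech(πx/α) dx = (α · 2^{iα} / √π) · Γ(iα/2 + 1/2) / Γ(iα/2 + 1). -/
open scoped Real
open MeasureTheory

/-- The generalized binomial coefficient `binom w z = Γ(w+1) / (Γ(z+1) Γ(w-z+1))`. -/
noncomputable def cbinom (w z : ℂ) : ℂ :=
  Complex.Gamma (w + 1) / (Complex.Gamma (z + 1) * Complex.Gamma (w - z + 1))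

/-- The complex hyperbolic secant `sech u = 2 / (e^u + e^{-u})`. -/
noncomputable def csech (u : ℂ) : ℂ := 2 / (Complex.exp u + Complex.exp (-u))

open Filter Topology Set in
/-- An integral depending holomorphically on a parameter, with locally uniform integrable bounds,
is holomorphic in the parameter. -/
theorem differentiableOn_integral_of_locally_dominated {X : Type*} [MeasurableSpace X]
    {μ : Measure X} {f : ℂ → X → ℂ} {U : Set ℂ} (hU : IsOpen U)
    (hmeas : ∀ z ∈ U, AEStronglyMeasurable (f z) μ)
    (hdiff : ∀ x, DifferentiableOn ℂ (f · x) U)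
    (hbound : ∀ S ⊆ U, IsCompact S → ∃ b : X → ℝ, Integrable b μ ∧
      ∀ᵐ x ∂μ, ∀ z ∈ S, ‖f z x‖ ≤ b x) :
    DifferentiableOn ℂ (fun z ↦ ∫ x, f z x ∂μ) U := by
  intro z₀ hz₀
  obtain ⟨ε, hε, hball⟩ := Metric.isOpen_iff.1 hU z₀ hz₀
  obtain ⟨b, hb, hfb⟩ := hbound (Metric.closedBall z₀ (ε / 2))
    ((Metric.closedBall_subset_ball (by linarith)).trans hball) (isCompact_closedBall _ _)
  have hat : ∀ x, ∀ z ∈ U, HasDerivAt (f · x) (deriv (f · x) z) z := fun x z hz ↦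
    ((hdiff x).differentiableAt (hU.mem_nhds hz)).hasDerivAt
  have hsub : Metric.ball z₀ (ε / 4) ⊆ U := (Metric.ball_subset_ball (by linarith)).trans hball
  refine (hasDerivAt_integral_of_dominated_loc_of_deriv_le
    (F' := fun z x ↦ deriv (f · x) z) (bound := fun x ↦ b x / (ε / 4))
    (Metric.ball_mem_nhds z₀ (by positivity : 0 < ε / 4)) ?_ ?_ ?_ ?_ (hb.div_const _)
    ?_).2.differentiableAt.differentiableWithinAt
  · filter_upwards [hU.mem_nhds hz₀] with z hz using hmeas z hz
  · exact hb.mono' (hmeas z₀ hz₀) (hfb.mono fun x hx ↦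
      hx z₀ (Metric.mem_closedBall_self (by positivity)))
  · have hlim : Tendsto (fun n : ℕ ↦ ((ε / 2 / (n + 1) : ℝ) : ℂ)) atTop (𝓝[≠] 0) := by
      refine tendsto_nhdsWithin_iff.2 ⟨?_, Eventually.of_forall fun n ↦ ?_⟩
      · have : Tendsto (fun n : ℕ ↦ (ε / 2 / (n + 1) : ℝ)) atTop (𝓝 0) := by
          simpa [div_eq_mul_inv] using
            (tendsto_one_div_add_atTop_nhds_zero_nat (𝕜 := ℝ)).const_mul (ε / 2)
        simpa only [Function.comp_def, Complex.ofReal_zero] using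
          (Complex.continuous_ofReal.tendsto 0).comp this
      · simp only [mem_compl_iff, mem_singleton_iff, Complex.ofReal_eq_zero]
        positivity
    refine aestronglyMeasurable_of_tendsto_ae atTop (f := fun (n : ℕ) x ↦
      (((ε / 2 / (n + 1) : ℝ) : ℂ))⁻¹ • (f (z₀ + ((ε / 2 / (n + 1) : ℝ) : ℂ)) x - f z₀ x))
      (fun n ↦ ?_) (ae_of_all _ fun x ↦ (hat x z₀ hz₀).tendsto_slope_zero.comp hlim)
    have hmem : z₀ + ((ε / 2 / (n + 1) : ℝ) : ℂ) ∈ U := hball ?_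
    · exact ((hmeas _ hmem).sub (hmeas _ hz₀)).const_smul (((ε / 2 / (n + 1) : ℝ) : ℂ))⁻¹
    rw [Metric.mem_ball, dist_self_add_left, Complex.norm_real, Real.norm_of_nonneg (by positivity)]
    calc ε / 2 / (n + 1) ≤ ε / 2 :=
          div_le_self (by positivity) (by linarith [n.cast_nonneg (α := ℝ)])
      _ < ε := by linarith
  · refine hfb.mono fun x hx z hz ↦ ?_
    have hsub' : Metric.closedBall z (ε / 4) ⊆ Metric.closedBall z₀ (ε / 2) :=
      Metric.closedBall_subset_closedBall' (by linarith [Metric.mem_ball.1 hz])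
    refine Complex.norm_deriv_le_of_forall_mem_sphere_norm_le (by positivity) ?_ fun y hy ↦
      hx y (hsub' (Metric.sphere_subset_closedBall hy))
    refine ((hdiff x).mono ?_).diffContOnCl
    exact (Metric.closure_ball_subset_closedBall.trans hsub').trans
      ((Metric.closedBall_subset_ball (by linarith)).trans hball)
  · exact ae_of_all _ fun x z hz ↦ hat x z (hsub hz)

theorem ofReal_exp_cpow (y : ℝ) (s : ℂ) : ((Real.exp y : ℝ) : ℂ) ^ s = Complex.exp (y * s) := by
  rw [Complex.cpow_def_of_ne_zero (by exact_mod_cast (Real.exp_pos y).ne'), ← Complex.ofReal_log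
    (Real.exp_pos y).le, Real.log_exp]

theorem sigmoid_two_mul (x : ℝ) :
    Real.sigmoid (2 * x) = Real.exp (x - Real.log (Real.exp x + Real.exp (-x))) := by
  have h : 0 < Real.exp x + Real.exp (-x) := by positivity
  have h' : Real.exp (-(2 * x)) = Real.exp (-x) / Real.exp x := by
    rw [← Real.exp_sub]; ring_nf
  rw [Real.sigmoid_def, Real.exp_sub, Real.exp_log h, h']
  field_simp

theorem integral_exp_mul_csech (u : ℝ) :
    ∫ x : ℝ, Complex.exp (-Complex.I * u * x) * csech x = π * csech (π * u / 2) := by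
  set a : ℂ := 1 / 2 - Complex.I * u / 2 with ha
  have hbeta : Complex.betaIntegral a (1 - a) = π * csech (π * u / 2) := by
    rw [Complex.betaIntegral_eq_Gamma_mul_div _ _ (by simp [ha]) (by simp [ha]; norm_num),
      Complex.Gamma_mul_Gamma_one_sub, add_sub_cancel, Complex.Gamma_one, div_one, csech]
    have : (π : ℂ) * a = π / 2 - (π * u / 2) * Complex.I := by rw [ha]; ring
    rw [this, Complex.sin_pi_div_two_sub, Complex.cos_mul_I, Complex.cosh,
      div_div_eq_mul_div, mul_div_assoc]
  rw [← hbeta, Complex.betaIntegral, intervalIntegral.integral_of_le zero_le_one,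
    integral_Ioc_eq_integral_Ioo]
  have himage : (fun x : ℝ ↦ Real.sigmoid (2 * x)) '' Set.univ = Set.Ioo 0 1 := by
    rw [← Real.range_sigmoid, Set.image_univ]
    exact (mul_left_surjective₀ (two_ne_zero (α := ℝ))).range_comp Real.sigmoid
  have hderiv : ∀ x : ℝ, HasDerivAt (fun x : ℝ ↦ Real.sigmoid (2 * x))
      (Real.sigmoid (2 * x) * (1 - Real.sigmoid (2 * x)) * 2) x := fun x ↦ by
    simpa [Function.comp_def] using
      HasDerivAt.comp x (h := fun x : ℝ ↦ 2 * x) (Real.hasDerivAt_sigmoid (2 * x))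
        ((hasDerivAt_id x).const_mul 2)
  rw [← himage, integral_image_eq_integral_abs_deriv_smul MeasurableSet.univ
    (fun x _ ↦ (hderiv x).hasDerivWithinAt)
    (fun x _ y _ h ↦ by simpa using Real.sigmoid_injective h), Measure.restrict_univ]
  refine integral_congr_ae (ae_of_all _ fun x ↦ ?_)
  have h1 : 1 - Real.sigmoid (2 * x) =
      Real.exp (-x - Real.log (Real.exp x + Real.exp (-x))) := by
    rw [← Real.sigmoid_neg, ← mul_neg, sigmoid_two_mul, neg_neg, add_comm (Real.exp (-x))]
  have h0 : 0 < Real.exp x + Real.exp (-x) := by positivity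
  have hL : Complex.exp ((Real.log (Real.exp x + Real.exp (-x)) : ℝ) : ℂ) =
      Complex.exp x + Complex.exp (-x) := by
    rw [← Complex.ofReal_exp, Real.exp_log h0]; push_cast; rfl
  have h2 : (1 : ℂ) - (Real.sigmoid (2 * x) : ℝ) = ((1 - Real.sigmoid (2 * x) : ℝ) : ℂ) := by
    push_cast; rfl
  simp only
  rw [h2, h1, sigmoid_two_mul, ofReal_exp_cpow, ofReal_exp_cpow, abs_of_pos (by positivity),
    Complex.real_smul, csech, ← hL]
  push_cast
  set L := ((Real.log (Real.exp x + Real.exp (-x)) : ℝ) : ℂ)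
  rw [div_eq_mul_inv, ← Complex.exp_neg, mul_left_comm, ← Complex.exp_add,
    mul_comm (_ * _) (2 : ℂ), mul_assoc (2 : ℂ), ← Complex.exp_add, ← Complex.exp_add,
    ← Complex.exp_add, ha]
  ring_nf

theorem integral_csech_mul_exp {a : ℝ} (ha : 0 < a) (t : ℝ) :
    ∫ x : ℝ, csech (π * x / a) * Complex.exp (-(x * t * Complex.I)) = a * csech (a * t / 2) := by
  have h := Measure.integral_comp_mul_left (fun y : ℝ ↦
    Complex.exp (-Complex.I * ((a * t / π : ℝ) : ℂ) * y) * csech y) (π / a)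
  have hpi : (π : ℂ) ≠ 0 := by exact_mod_cast Real.pi_ne_zero
  have ha' : (a : ℂ) ≠ 0 := by exact_mod_cast ha.ne'
  rw [integral_exp_mul_csech, abs_of_pos (by positivity), Complex.real_smul] at h
  convert h using 1
  · refine integral_congr_ae (ae_of_all _ fun x ↦ ?_)
    simp only
    rw [mul_comm]
    congr 2
    · push_cast; field_simp
    · push_cast; ring
  · push_cast
    rw [inv_div]
    field_simp

/-- The integrand `(1 + e^u)^w e^{-zu}`, holomorphic for `u` in the left half-plane. -/
noncomputable def binomKernel (w z u : ℂ) : ℂ :=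
  (1 + Complex.exp u) ^ w * Complex.exp (-(z * u))

theorem norm_one_add_exp_cpow_le {w u : ℂ} (hw : 0 ≤ w.re) (hu : u.re ≤ 0) :
    ‖(1 + Complex.exp u) ^ w‖ ≤ 2 ^ w.re * Real.exp (π * |w.im|) := by
  refine (Complex.norm_cpow_le _ _).trans ?_
  rw [div_eq_mul_inv, ← Real.exp_neg]
  have h1 : ‖1 + Complex.exp u‖ ≤ 2 := by
    refine (norm_add_le _ _).trans ?_
    rw [norm_one, Complex.norm_exp]
    linarith [Real.exp_le_one_iff.2 hu]
  gcongr
  refine (neg_le_abs _).trans ?_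
  rw [abs_mul]
  gcongr
  exact Complex.abs_arg_le_pi _

theorem norm_binomKernel_le {w z u : ℂ} (hw : 0 ≤ w.re) (hu : u.re ≤ 0) (hu' : |u.im| ≤ π) :
    ‖binomKernel w z u‖ ≤
      2 ^ w.re * Real.exp (π * |w.im|) * Real.exp (-(z.re * u.re) + |z.im| * π) := by
  rw [binomKernel, norm_mul, Complex.norm_exp]
  gcongr
  · exact norm_one_add_exp_cpow_le hw hu
  · rw [Complex.neg_re, Complex.mul_re]
    have : z.im * u.im ≤ |z.im| * π := (le_abs_self _).trans (by rw [abs_mul]; gcongr)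
    linarith

theorem one_add_exp_mem_slitPlane {u : ℂ} (hu : u.re < 0) :
    1 + Complex.exp u ∈ Complex.slitPlane :=
  Complex.mem_slitPlane_of_norm_lt_one (by rwa [Complex.norm_exp, Real.exp_lt_one_iff])

theorem one_add_exp_mul_I (t : ℝ) : 1 + Complex.exp (t * Complex.I) =
    ((2 * Real.cos (t / 2) : ℝ) : ℂ) * Complex.exp (t / 2 * Complex.I) := by
  push_cast
  rw [Complex.cos, mul_div_cancel₀ _ two_ne_zero, add_mul, ← Complex.exp_add, ← Complex.exp_add]
  ring_nf
  rw [Complex.exp_zero, add_comm]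

theorem one_add_exp_mul_I_mem_slitPlane {t : ℝ} (ht : t ∈ Set.Ioo (-π) π) :
    1 + Complex.exp (t * Complex.I) ∈ Complex.slitPlane := by
  left
  have h : 0 < Real.cos (t / 2) :=
    Real.cos_pos_of_mem_Ioo ⟨by linarith [ht.1], by linarith [ht.2]⟩
  have h' := Real.cos_sq (t / 2)
  rw [mul_div_cancel₀ _ two_ne_zero] at h'
  rw [Complex.add_re, Complex.one_re, Complex.exp_ofReal_mul_I_re]
  nlinarith

theorem differentiableAt_binomKernel (w z : ℂ) {u : ℂ}
    (hu : 1 + Complex.exp u ∈ Complex.slitPlane) : DifferentiableAt ℂ (binomKernel w z) u := by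
  unfold binomKernel
  have h : DifferentiableAt ℂ (fun u ↦ (1 + Complex.exp u) ^ w) u :=
    DifferentiableAt.cpow (by fun_prop) (by fun_prop) hu
  exact h.mul (by fun_prop)

theorem measurable_binomKernel (w z : ℂ) : Measurable (binomKernel w z) := by
  unfold binomKernel
  fun_prop

theorem binomKernel_sub (w z : ℂ) (y : ℝ) :
    binomKernel w z (y + π * Complex.I) - binomKernel w z (y - π * Complex.I) =
      -2 * Complex.I * Complex.sin (π * z) *
        ((1 - (Real.exp y : ℝ)) ^ w * ((Real.exp y : ℝ) : ℂ) ^ (-z)) := by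
  rw [ofReal_exp_cpow]
  have h1 : Complex.exp (y + π * Complex.I) = -Complex.exp y := by
    rw [Complex.exp_add, Complex.exp_pi_mul_I]; ring
  have h2 : Complex.exp (y - π * Complex.I) = -Complex.exp y := by
    rw [sub_eq_add_neg, Complex.exp_add, Complex.exp_neg, Complex.exp_pi_mul_I]; norm_num
  have h3 : Complex.exp (-(z * (y + π * Complex.I))) =
      Complex.exp (y * -z) * Complex.exp (-(π * z) * Complex.I) := by
    rw [← Complex.exp_add]; ring_nf
  have h4 : Complex.exp (-(z * (y - π * Complex.I))) =
      Complex.exp (y * -z) * Complex.exp (π * z * Complex.I) := by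
    rw [← Complex.exp_add]; ring_nf
  rw [binomKernel, binomKernel, h1, h2, h3, h4, Complex.sin, Complex.ofReal_exp,
    ← sub_eq_add_neg]
  linear_combination ((1 - Complex.exp y) ^ w * Complex.exp (y * -z) *
    (Complex.exp (-(π * z) * Complex.I) - Complex.exp (π * z * Complex.I))) * Complex.I_sq

theorem integral_binomKernel_sub (w z : ℂ) {s t : ℝ} (hst : s ≤ t) (ht : t < 0) :
    (∫ y in -π..π, binomKernel w z (t + y * Complex.I)) -
      (∫ y in -π..π, binomKernel w z (s + y * Complex.I)) =
      -2 * Complex.sin (π * z) *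
        ∫ r in (Real.exp s)..(Real.exp t), (r : ℂ) ^ (-z - 1) * (1 - (r : ℂ)) ^ (w + 1 - 1) := by
  have hdiff : DifferentiableOn ℂ (binomKernel w z) {u | u.re < 0} := fun u hu ↦
    (differentiableAt_binomKernel w z
      (one_add_exp_mem_slitPlane hu)).differentiableWithinAt
  have hcont : ∀ c : ℝ, IntervalIntegrable (fun y : ℝ ↦ binomKernel w z (y + c * Complex.I))
      volume s t := fun c ↦ by
    refine (hdiff.continuousOn.comp (by fun_prop) fun y hy ↦ ?_).intervalIntegrable
    rw [Set.uIcc_of_le hst] at hy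
    simpa using hy.2.trans_lt ht
  have hrect := Complex.integral_boundary_rect_eq_zero_of_differentiableOn (binomKernel w z)
    ⟨s, -π⟩ ⟨t, π⟩ (hdiff.mono fun u hu ↦ by
      have := hu.1
      simp only [Set.mem_preimage, Set.uIcc_of_le hst] at this
      exact this.2.trans_lt ht)
  have hsubst := intervalIntegral.integral_deriv_smul_comp' (a := s) (b := t) (f := Real.exp)
    (g := fun r : ℝ ↦ (r : ℂ) ^ (-z - 1) * (1 - (r : ℂ)) ^ (w + 1 - 1))
    (fun y _ ↦ Real.hasDerivAt_exp y) Real.continuous_exp.continuousOn (by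
      rintro _ ⟨y, hy, rfl⟩
      rw [Set.uIcc_of_le hst] at hy
      have hy1 : Real.exp y < 1 := Real.exp_lt_one_iff.2 (hy.2.trans_lt ht)
      refine (ContinuousAt.mul (ContinuousAt.cpow (by fun_prop) (by fun_prop) (Or.inl ?_))
        (ContinuousAt.cpow (by fun_prop) (by fun_prop) (Or.inl ?_))).continuousWithinAt
      · rw [Complex.ofReal_re]; exact Real.exp_pos y
      · rw [← Complex.ofReal_one, ← Complex.ofReal_sub, Complex.ofReal_re]
        linarith)
  have hint := intervalIntegral.integral_congr (μ := volume) (a := s) (b := t)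
    fun y _ ↦ binomKernel_sub w z y
  simp only [sub_eq_add_neg (_ : ℂ) (π * Complex.I)] at hint
  have hc2 := hcont (-π)
  simp only [Complex.ofReal_neg, neg_mul, smul_eq_mul] at hrect hc2
  rw [intervalIntegral.integral_sub (hcont π) hc2, intervalIntegral.integral_const_mul] at hint
  have hker : ∫ y in s..t, (1 - ((Real.exp y : ℝ) : ℂ)) ^ w * ((Real.exp y : ℝ) : ℂ) ^ (-z) =
      ∫ r in (Real.exp s)..(Real.exp t), (r : ℂ) ^ (-z - 1) * (1 - (r : ℂ)) ^ (w + 1 - 1) := by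
    rw [← hsubst]
    refine intervalIntegral.integral_congr fun y _ ↦ ?_
    have hne : ((Real.exp y : ℝ) : ℂ) ≠ 0 := by exact_mod_cast (Real.exp_pos y).ne'
    simp only [Function.comp, Complex.real_smul]
    rw [Complex.cpow_sub _ _ hne, Complex.cpow_one, add_sub_cancel_right]
    field_simp
  rw [hker] at hint
  linear_combination (-Complex.I) * hrect - Complex.I * hint +
    ((∫ y in -π..π, binomKernel w z (t + y * Complex.I)) -
      (∫ y in -π..π, binomKernel w z (s + y * Complex.I)) + 2 * Complex.sin (π * z) *
        ∫ r in (Real.exp s)..(Real.exp t), (r : ℂ) ^ (-z - 1) * (1 - (r : ℂ)) ^ (w + 1 - 1)) *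
      Complex.I_sq

open Filter Topology in
theorem tendsto_integral_binomKernel_atBot {w z : ℂ} (hw : 0 ≤ w.re) (hz : z.re < 0) :
    Tendsto (fun s : ℝ ↦ ∫ y in -π..π, binomKernel w z (s + y * Complex.I)) atBot (𝓝 0) := by
  have hlim : Tendsto (fun s : ℝ ↦ 2 ^ w.re * Real.exp (π * |w.im|) *
      Real.exp (-(z.re * s) + |z.im| * π) * |π - -π|) atBot (𝓝 0) := by
    have h : Tendsto (fun s : ℝ ↦ -(z.re * s) + |z.im| * π) atBot atBot := by
      refine tendsto_atBot_add_const_right _ _ ?_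
      simpa only [neg_mul, id] using tendsto_id.const_mul_atBot (neg_pos.2 hz)
    simpa using ((Real.tendsto_exp_atBot.comp h).const_mul
      (2 ^ w.re * Real.exp (π * |w.im|))).mul_const |π - -π|
  refine squeeze_zero_norm' ?_ hlim
  filter_upwards [eventually_le_atBot 0] with s hs
  refine intervalIntegral.norm_integral_le_of_norm_le_const fun y hy ↦ ?_
  rw [Set.uIoc_of_le (by linarith [Real.pi_pos])] at hy
  simpa using norm_binomKernel_le (w := w) (z := z) (u := s + y * Complex.I) hw (by simpa using hs)
    (by simpa using abs_le.2 ⟨hy.1.le, hy.2⟩)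

open Filter Topology in
theorem tendsto_integral_binomKernel_zero {w z : ℂ} (hw : 0 ≤ w.re) :
    Tendsto (fun s : ℝ ↦ ∫ y in -π..π, binomKernel w z (s + y * Complex.I)) (𝓝[<] 0)
      (𝓝 (∫ y in -π..π, binomKernel w z (y * Complex.I))) := by
  refine intervalIntegral.tendsto_integral_filter_of_dominated_convergence
    (fun _ ↦ 2 ^ w.re * Real.exp (π * |w.im|) * Real.exp (|z.re| + |z.im| * π))
    (Eventually.of_forall fun s ↦ ?_) ?_ intervalIntegrable_const ?_
  · exact ((measurable_binomKernel w z).comp (by fun_prop)).aestronglyMeasurable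
  · filter_upwards [self_mem_nhdsWithin, mem_nhdsWithin_of_mem_nhds (Ioi_mem_nhds neg_one_lt_zero)]
      with s hs hs'
    refine ae_of_all _ fun y hy ↦ ?_
    rw [Set.uIoc_of_le (by linarith [Real.pi_pos])] at hy
    have hs0 : s ≤ 0 := le_of_lt hs
    refine (norm_binomKernel_le (u := s + y * Complex.I) hw (by simpa using hs0)
      (by simpa using abs_le.2 ⟨hy.1.le, hy.2⟩)).trans ?_
    gcongr
    refine (neg_le_abs _).trans ?_
    have hs1 : |s| ≤ 1 := abs_le.2 ⟨le_of_lt hs', by linarith⟩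
    simpa [abs_mul] using mul_le_mul_of_nonneg_left hs1 (abs_nonneg z.re)
  · have hne : ∀ᵐ y : ℝ, y ≠ π := by simp [ae_iff]
    filter_upwards [hne] with y hy hy'
    rw [Set.uIoc_of_le (by linarith [Real.pi_pos])] at hy'
    have hcont := (differentiableAt_binomKernel w z
      (one_add_exp_mul_I_mem_slitPlane ⟨hy'.1, lt_of_le_of_ne hy'.2 hy⟩)).continuousAt
    have hlim : Tendsto (fun s : ℝ ↦ (s + y * Complex.I : ℂ)) (𝓝[<] 0) (𝓝 (y * Complex.I)) := by
      have : Continuous fun s : ℝ ↦ (s + y * Complex.I : ℂ) := by fun_prop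
      simpa using (this.tendsto 0).mono_left nhdsWithin_le_nhds
    exact hcont.tendsto.comp hlim

open Filter Topology in
theorem integral_binomKernel_eq_betaIntegral {w z : ℂ} (hw : 0 ≤ w.re) (hz : z.re < 0) :
    ∫ y in -π..π, binomKernel w z (y * Complex.I) =
      -2 * Complex.sin (π * z) * Complex.betaIntegral (-z) (w + 1) := by
  set k : ℝ → ℂ := fun r ↦ (r : ℂ) ^ (-z - 1) * (1 - (r : ℂ)) ^ (w + 1 - 1) with hk
  have hkint : IntervalIntegrable k volume 0 1 :=
    Complex.betaIntegral_convergent (by simpa using hz)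
      (by rw [Complex.add_re, Complex.one_re]; linarith)
  have hP := intervalIntegral.continuousOn_primitive_interval' hkint Set.left_mem_uIcc
  rw [Set.uIcc_of_le zero_le_one] at hP
  set P : ℝ → ℂ := fun b ↦ ∫ r in (0 : ℝ)..b, k r
  have hmem : ∀ {t : ℝ}, t ≤ 0 → Real.exp t ∈ Set.Icc (0 : ℝ) 1 := fun ht ↦
    ⟨(Real.exp_pos _).le, Real.exp_le_one_iff.2 ht⟩
  have hint : ∀ {t : ℝ}, t ≤ 0 → IntervalIntegrable k volume 0 (Real.exp t) := fun ht ↦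
    hkint.mono_set (by
      rw [Set.uIcc_of_le zero_le_one, Set.uIcc_of_le (Real.exp_pos _).le]
      exact Set.Icc_subset_Icc_right (hmem ht).2)
  have hsub : ∀ {s t : ℝ}, s ≤ t → t < 0 →
      (∫ y in -π..π, binomKernel w z (t + y * Complex.I)) -
        (∫ y in -π..π, binomKernel w z (s + y * Complex.I)) =
      -2 * Complex.sin (π * z) * (P (Real.exp t) - P (Real.exp s)) := fun hst ht ↦ by
    rw [integral_binomKernel_sub w z hst ht,
      intervalIntegral.integral_interval_sub_left (hint ht.le) (hint (hst.trans ht.le))]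
  have hP0 : Tendsto (fun s ↦ P (Real.exp s)) atBot (𝓝 0) := by
    have h0 : P 0 = 0 := intervalIntegral.integral_same
    rw [← h0]
    refine (hP 0 (by simp)).tendsto.comp (tendsto_nhdsWithin_iff.2 ⟨Real.tendsto_exp_atBot, ?_⟩)
    filter_upwards [eventually_le_atBot 0] with s hs using hmem hs
  have hP1 : Tendsto (fun s ↦ P (Real.exp s)) (𝓝[<] 0) (𝓝 (P 1)) := by
    refine (hP 1 (by simp)).tendsto.comp (tendsto_nhdsWithin_iff.2 ⟨?_, ?_⟩)
    · simpa using (Real.continuous_exp.tendsto 0).mono_left nhdsWithin_le_nhds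
    · filter_upwards [self_mem_nhdsWithin] with s hs using hmem (le_of_lt hs)
  have hleft : ∀ {t : ℝ}, t < 0 → ∫ y in -π..π, binomKernel w z (t + y * Complex.I) =
      -2 * Complex.sin (π * z) * P (Real.exp t) := fun {t} ht ↦ by
    have h1 := tendsto_const_nhds (x := ∫ y in -π..π, binomKernel w z (t + y * Complex.I)).sub
      (tendsto_integral_binomKernel_atBot hw hz)
    have h2 := (tendsto_const_nhds (x := P (Real.exp t)).sub hP0).const_mul
      (-2 * Complex.sin (π * z))
    rw [sub_zero] at h1 h2
    refine tendsto_nhds_unique h1 (h2.congr' ?_)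
    filter_upwards [eventually_le_atBot t] with s hs using (hsub hs ht).symm
  refine tendsto_nhds_unique (tendsto_integral_binomKernel_zero hw)
    ((hP1.const_mul (-2 * Complex.sin (π * z))).congr' ?_)
  filter_upwards [self_mem_nhdsWithin] with t ht using (hleft ht).symm

theorem integral_binomKernel_of_re_neg {w z : ℂ} (hw : 0 ≤ w.re) (hz : z.re < 0) :
    ∫ y in -π..π, binomKernel w z (y * Complex.I) =
      2 * π * Complex.Gamma (w + 1) *
        ((Complex.Gamma (z + 1))⁻¹ * (Complex.Gamma (w - z + 1))⁻¹) := by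
  rw [integral_binomKernel_eq_betaIntegral hw hz, Complex.betaIntegral_eq_Gamma_mul_div _ _
    (by simpa using hz) (by rw [Complex.add_re, Complex.one_re]; linarith)]
  have hrefl := Complex.Gamma_mul_Gamma_one_sub (-z)
  rw [sub_neg_eq_add, add_comm 1 z, mul_neg, Complex.sin_neg] at hrefl
  have hne : Complex.Gamma (-z) ≠ 0 := Complex.Gamma_ne_zero_of_re_pos (by simpa using hz)
  have hkey : -2 * Complex.sin (π * z) * Complex.Gamma (-z) =
      2 * π * (Complex.Gamma (z + 1))⁻¹ := by
    generalize Complex.sin (π * z) = σ at hrefl ⊢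
    by_cases hs : σ = 0
    · have : Complex.Gamma (z + 1) = 0 := by simpa [hs, hne] using hrefl
      simp [hs, this]
    · have hpi : (π : ℂ) ≠ 0 := by exact_mod_cast Real.pi_ne_zero
      have hs' : -σ ≠ 0 := neg_ne_zero.2 hs
      have hz1 : Complex.Gamma (z + 1) ≠ 0 := fun h ↦
        div_ne_zero hpi hs' (by rw [← hrefl, h, mul_zero])
      rw [eq_div_iff hs'] at hrefl
      rw [← div_eq_mul_inv, eq_div_iff hz1]
      linear_combination 2 * hrefl
  rw [show -z + (w + 1) = w - z + 1 by ring]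
  linear_combination (Complex.Gamma (w + 1) * (Complex.Gamma (w - z + 1))⁻¹) * hkey

theorem integral_binomKernel {w : ℂ} (hw : 0 ≤ w.re) (z : ℂ) :
    ∫ y in -π..π, binomKernel w z (y * Complex.I) =
      2 * π * Complex.Gamma (w + 1) *
        ((Complex.Gamma (z + 1))⁻¹ * (Complex.Gamma (w - z + 1))⁻¹) := by
  have hpi : -π ≤ π := by linarith [Real.pi_pos]
  have hleft : Differentiable ℂ fun z ↦ ∫ y in -π..π, binomKernel w z (y * Complex.I) := by
    simp only [intervalIntegral.integral_of_le hpi]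
    rw [← differentiableOn_univ]
    refine differentiableOn_integral_of_locally_dominated isOpen_univ (fun z _ ↦ ?_) (fun y ↦ ?_)
      fun S _ hS ↦ ?_
    · exact ((measurable_binomKernel w z).comp (by fun_prop)).aestronglyMeasurable
    · unfold binomKernel
      fun_prop
    · obtain ⟨C, hC⟩ := hS.isBounded.exists_norm_le
      refine ⟨fun _ ↦ 2 ^ w.re * Real.exp (π * |w.im|) * Real.exp (C * π), integrable_const _, ?_⟩
      filter_upwards [ae_restrict_mem measurableSet_Ioc] with y hy z hz
      refine (norm_binomKernel_le (u := y * Complex.I) hw (by simp)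
        (by simpa using abs_le.2 ⟨hy.1.le, hy.2⟩)).trans ?_
      gcongr
      have : |z.im| * π ≤ C * π := by gcongr; exact (Complex.abs_im_le_norm z).trans (hC z hz)
      simpa using this
  have hright : Differentiable ℂ fun z ↦ 2 * π * Complex.Gamma (w + 1) *
      ((Complex.Gamma (z + 1))⁻¹ * (Complex.Gamma (w - z + 1))⁻¹) := by
    have h1 := Complex.differentiable_one_div_Gamma.comp (f := fun z : ℂ ↦ z + 1) (by fun_prop)
    have h2 := Complex.differentiable_one_div_Gamma.comp (f := fun z : ℂ ↦ w - z + 1) (by fun_prop)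
    exact (h1.mul h2).const_mul _
  refine congr_fun (AnalyticOnNhd.eq_of_eventuallyEq (z₀ := -1)
    (fun z _ ↦ hleft.analyticAt z) (fun z _ ↦ hright.analyticAt z) ?_) z
  filter_upwards [(isOpen_lt Complex.continuous_re continuous_const).mem_nhds
    (show (-1 : ℂ).re < 0 by simp)] with z hz using integral_binomKernel_of_re_neg hw hz

theorem exp_add_exp_neg_norm_ge (u : ℂ) :
    Real.exp |u.re| - Real.exp (-|u.re|) ≤ ‖Complex.exp u + Complex.exp (-u)‖ := by
  rcases abs_cases u.re with ⟨h, _⟩ | ⟨h, _⟩ <;> rw [h]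
  · simpa [Complex.norm_exp] using norm_sub_le_norm_add (Complex.exp u) (Complex.exp (-u))
  · simpa [Complex.norm_exp, add_comm] using
      norm_sub_le_norm_add (Complex.exp (-u)) (Complex.exp u)

theorem pi_mul_div_re (x : ℝ) (a : ℂ) : (π * x / a : ℂ).re = π * (a⁻¹).re * x := by
  rw [div_eq_mul_inv, ← Complex.ofReal_mul, Complex.re_ofReal_mul]
  ring

theorem inv_re_pos {a : ℂ} (ha : 0 < a.re) : 0 < (a⁻¹).re := by
  rw [Complex.inv_re]
  exact div_pos ha (Complex.normSq_pos.2 fun h ↦ by simp [h] at ha)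

theorem exp_add_exp_neg_ne_zero {a : ℂ} (ha : 0 < a.re) (x : ℝ) :
    Complex.exp (π * x / a) + Complex.exp (-(π * x / a)) ≠ 0 := by
  by_cases hx : x = 0
  · simp [hx]
  · refine norm_pos_iff.1 (lt_of_lt_of_le ?_ (exp_add_exp_neg_norm_ge _))
    have : 0 < |(π * x / a : ℂ).re| := by
      rw [pi_mul_div_re]
      exact abs_pos.2 (mul_ne_zero (mul_pos Real.pi_pos (inv_re_pos ha)).ne' hx)
    exact sub_pos.2 (Real.exp_lt_exp.2 (by linarith))

theorem exists_norm_csech_le {S : Set ℂ} (hS : IsCompact S) (hS' : ∀ a ∈ S, 0 < a.re) :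
    ∃ C c : ℝ, 0 < c ∧ ∀ a ∈ S, ∀ x : ℝ, ‖csech (π * x / a)‖ ≤ C * Real.exp (-(c * |x|)) := by
  rcases S.eq_empty_or_nonempty with rfl | hne
  · exact ⟨0, 1, one_pos, by simp⟩
  have ha0 : ∀ a ∈ S, a ≠ 0 := fun a ha h ↦ by simpa [h] using hS' a ha
  obtain ⟨a₀, ha₀, hmin⟩ := hS.exists_isMinOn hne (f := fun a ↦ π * (a⁻¹).re) (by
    exact continuousOn_const.mul (Complex.continuous_re.comp_continuousOn
      (continuousOn_id.inv₀ ha0)))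
  set c := π * (a₀⁻¹).re
  have hc : 0 < c := mul_pos Real.pi_pos (inv_re_pos (hS' a₀ ha₀))
  have hcont : ContinuousOn (fun p : ℂ × ℝ ↦ csech (π * p.2 / p.1))
      (S ×ˢ Set.Icc (-(1 / c)) (1 / c)) := by
    have hdiv : ContinuousOn (fun p : ℂ × ℝ ↦ (π * p.2 / p.1 : ℂ))
        (S ×ˢ Set.Icc (-(1 / c)) (1 / c)) :=
      ContinuousOn.div (by fun_prop) (by fun_prop) fun p hp ↦ ha0 _ hp.1
    exact continuousOn_const.div (hdiv.cexp.add hdiv.neg.cexp)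
      fun p hp ↦ exp_add_exp_neg_ne_zero (hS' _ hp.1) p.2
  obtain ⟨M, hM⟩ := ((hS.prod isCompact_Icc).bddAbove_image hcont.norm)
  refine ⟨4 + |M| * Real.exp 1, c, hc, fun a ha x ↦ ?_⟩
  have hca : c ≤ π * (a⁻¹).re := hmin ha
  rw [add_mul]
  rcases le_total |x| (1 / c) with hx | hx
  · have h1 : ‖csech (π * x / a)‖ ≤ |M| :=
      (hM ⟨(a, x), ⟨ha, abs_le.1 hx⟩, rfl⟩).trans (le_abs_self M)
    have h2 : 1 ≤ Real.exp 1 * Real.exp (-(c * |x|)) := by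
      rw [← Real.exp_add, Real.one_le_exp_iff]
      have := (le_div_iff₀ hc).1 hx
      linarith
    have h3 := mul_le_mul_of_nonneg_left h2 (abs_nonneg M)
    have h4 := Real.exp_pos (-(c * |x|))
    linarith
  · have hx' : 1 ≤ c * |x| := by
      have := (div_le_iff₀ hc).1 hx
      linarith
    have hre : c * |x| ≤ |(π * x / a : ℂ).re| := by
      rw [pi_mul_div_re, abs_mul]
      exact mul_le_mul_of_nonneg_right (hca.trans (le_abs_self _)) (abs_nonneg x)
    have hlow : Real.exp (c * |x|) / 2 ≤
        ‖Complex.exp (π * x / a) + Complex.exp (-(π * x / a))‖ := by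
      refine le_trans ?_ (exp_add_exp_neg_norm_ge _)
      have h1 := Real.exp_le_exp.2 hre
      have h2 := Real.exp_le_exp.2 (neg_le_neg hre)
      have h3 : 2 * Real.exp (-(c * |x|)) ≤ Real.exp (c * |x|) := by
        have h4 := Real.add_one_le_exp (c * |x|)
        have h5 : Real.exp (-(c * |x|)) ≤ 1 := Real.exp_le_one_iff.2 (by linarith)
        linarith
      linarith
    have h5 : ‖csech (π * x / a)‖ ≤ 4 * Real.exp (-(c * |x|)) := by
      rw [csech, norm_div, Complex.norm_ofNat, Real.exp_neg, ← div_eq_mul_inv]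
      refine (div_le_div_of_nonneg_left zero_le_two (by positivity) hlow).trans (le_of_eq ?_)
      field_simp
      norm_num
    have h6 : 0 ≤ |M| * Real.exp 1 * Real.exp (-(c * |x|)) := by positivity
    linarith

theorem exists_norm_inv_Gamma_mul_le (n : ℕ) : ∀ S : Set ℂ, IsCompact S →
    (∀ w ∈ S, -(n : ℝ) ≤ w.re) → ∀ ε > 0, ∃ C : ℝ, ∀ w ∈ S, ∀ x : ℝ,
      ‖(Complex.Gamma (x + 1))⁻¹ * (Complex.Gamma (w - x + 1))⁻¹‖ ≤ C * Real.exp (ε * |x|) := by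
  induction n with
  | zero =>
    intro S hS hre ε hε
    have hcont : Continuous fun w : ℂ ↦ 2 ^ w.re * Real.exp (π * |w.im|) *
        ‖(Complex.Gamma (w + 1))⁻¹‖ := by
      refine ((continuous_const.rpow Complex.continuous_re (by simp)).mul
        (by fun_prop)).mul ?_
      exact (Complex.differentiable_one_div_Gamma.continuous.comp (by fun_prop :
        Continuous fun w : ℂ ↦ w + 1)).norm
    obtain ⟨C, hC⟩ := hS.bddAbove_image hcont.continuousOn
    refine ⟨C, fun w hw x ↦ ?_⟩
    have hw0 : 0 ≤ w.re := by simpa using hre w hw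
    have hpi : (2 * π : ℂ) ≠ 0 := by simp [Real.pi_ne_zero]
    have hG : Complex.Gamma (w + 1) ≠ 0 :=
      Complex.Gamma_ne_zero_of_re_pos (by rw [Complex.add_re, Complex.one_re]; linarith)
    have heq : (Complex.Gamma (x + 1))⁻¹ * (Complex.Gamma (w - x + 1))⁻¹ =
        (2 * π : ℂ)⁻¹ * (Complex.Gamma (w + 1))⁻¹ *
          ∫ y in -π..π, binomKernel w x (y * Complex.I) := by
      rw [integral_binomKernel hw0]
      field_simp
    have hK : ‖∫ y in -π..π, binomKernel w x (y * Complex.I)‖ ≤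
        2 ^ w.re * Real.exp (π * |w.im|) * |π - -π| := by
      refine intervalIntegral.norm_integral_le_of_norm_le_const fun y hy ↦ ?_
      rw [Set.uIoc_of_le (by linarith [Real.pi_pos])] at hy
      simpa using norm_binomKernel_le (z := x) (u := y * Complex.I) hw0 (by simp)
        (by simpa using abs_le.2 ⟨hy.1.le, hy.2⟩)
    have hb : ‖(Complex.Gamma (x + 1))⁻¹ * (Complex.Gamma (w - x + 1))⁻¹‖ ≤
        2 ^ w.re * Real.exp (π * |w.im|) * ‖(Complex.Gamma (w + 1))⁻¹‖ := by
      rw [heq, norm_mul, norm_mul]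
      refine (mul_le_mul_of_nonneg_left hK (by positivity)).trans (le_of_eq ?_)
      have : ‖((2 * π : ℂ))⁻¹‖ = (2 * π)⁻¹ := by
        simp [abs_of_pos Real.pi_pos]
      rw [this, sub_neg_eq_add, ← two_mul, abs_of_pos (mul_pos two_pos Real.pi_pos)]
      field_simp [Real.pi_ne_zero]
    refine hb.trans ((hC ⟨w, hw, rfl⟩).trans ?_)
    refine le_mul_of_one_le_right ?_ (Real.one_le_exp (by positivity))
    exact (by positivity : (0 : ℝ) ≤ 2 ^ w.re * Real.exp (π * |w.im|) *
      ‖(Complex.Gamma (w + 1))⁻¹‖).trans (hC ⟨w, hw, rfl⟩)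
  | succ n ih =>
    intro S hS hre ε hε
    obtain ⟨C, hC⟩ := ih ((· + 1) '' S) (hS.image (by fun_prop)) (by
      rintro _ ⟨w, hw, rfl⟩
      have := hre w hw
      push_cast at this
      rw [Complex.add_re, Complex.one_re]
      linarith) (ε / 2) (by positivity)
    obtain ⟨B, hB⟩ := hS.isBounded.exists_norm_le
    refine ⟨(|B| + 1 + 2 / ε) * |C|, fun w hw x ↦ ?_⟩
    have hrec : (Complex.Gamma (x + 1))⁻¹ * (Complex.Gamma (w - x + 1))⁻¹ =
        (w - x + 1) * ((Complex.Gamma (x + 1))⁻¹ * (Complex.Gamma (w + 1 - x + 1))⁻¹) := by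
      rw [Complex.one_div_Gamma_eq_self_mul_one_div_Gamma_add_one (w - x + 1),
        show w - x + 1 + 1 = w + 1 - x + 1 by ring]
      ring
    have hlin : ‖w - x + 1‖ ≤ (|B| + 1 + 2 / ε) * Real.exp (ε / 2 * |x|) := by
      have h1 : ‖w - x + 1‖ ≤ |B| + |x| + 1 := by
        refine (norm_add_le _ _).trans ?_
        rw [norm_one]
        gcongr
        refine (norm_sub_le _ _).trans ?_
        rw [Complex.norm_real, Real.norm_eq_abs]
        gcongr
        exact (hB w hw).trans (le_abs_self B)
      have h2 := Real.add_one_le_exp (ε / 2 * |x|)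
      have h3 : |x| ≤ 2 / ε * Real.exp (ε / 2 * |x|) := by
        rw [div_mul_eq_mul_div, le_div_iff₀ hε]
        linarith
      have h4 : 1 ≤ Real.exp (ε / 2 * |x|) := Real.one_le_exp (by positivity)
      have h5 := mul_le_mul_of_nonneg_left h4 (by positivity : 0 ≤ |B| + 1)
      linarith
    have hexp : Real.exp (ε * |x|) = Real.exp (ε / 2 * |x|) * Real.exp (ε / 2 * |x|) := by
      rw [← Real.exp_add]; ring_nf
    rw [hrec, norm_mul, hexp]
    refine (mul_le_mul hlin ((hC (w + 1) ⟨w, hw, rfl⟩ x).trans (mul_le_mul_of_nonneg_right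
      (le_abs_self C) (Real.exp_pos _).le)) (norm_nonneg _) (by positivity)).trans (le_of_eq ?_)
    ring

theorem integrable_exp_neg_mul_abs {c : ℝ} (hc : 0 < c) :
    Integrable fun x : ℝ ↦ Real.exp (-(c * |x|)) := by
  rw [← integrableOn_univ, ← Set.Iic_union_Ioi (a := (0 : ℝ))]
  refine IntegrableOn.union ?_ ?_
  · refine (integrableOn_exp_mul_Iic hc 0).congr_fun (fun x hx ↦ ?_) measurableSet_Iic
    simp only [abs_of_nonpos (Set.mem_Iic.1 hx), mul_neg, neg_neg]
  · refine (exp_neg_integrableOn_Ioi 0 hc).congr_fun (fun x hx ↦ ?_) measurableSet_Ioi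
    simp only [abs_of_pos (Set.mem_Ioi.1 hx), neg_mul]

theorem continuous_csech_div {a : ℂ} (ha : 0 < a.re) :
    Continuous fun x : ℝ ↦ csech (π * x / a) := by
  unfold csech
  exact continuous_const.div (by fun_prop) fun x ↦ exp_add_exp_neg_ne_zero ha x

theorem continuous_inv_Gamma_mul (w : ℂ) : Continuous fun x : ℝ ↦
    (Complex.Gamma (x + 1))⁻¹ * (Complex.Gamma (w - x + 1))⁻¹ :=
  (Complex.differentiable_one_div_Gamma.continuous.comp
    (by fun_prop : Continuous fun x : ℝ ↦ (x + 1 : ℂ))).mul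
    (Complex.differentiable_one_div_Gamma.continuous.comp
      (by fun_prop : Continuous fun x : ℝ ↦ (w - x + 1 : ℂ)))

theorem differentiableOn_integral_inv_Gamma_mul_csech :
    DifferentiableOn ℂ (fun a : ℂ ↦ ∫ x : ℝ, (Complex.Gamma (x + 1))⁻¹ *
      (Complex.Gamma (Complex.I * a - x + 1))⁻¹ * csech (π * x / a)) {a | 0 < a.re} := by
  refine differentiableOn_integral_of_locally_dominated
    (isOpen_lt continuous_const Complex.continuous_re) (fun a ha ↦ ?_) (fun x ↦ ?_)
    fun S hSU hS ↦ ?_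
  · exact ((continuous_inv_Gamma_mul (Complex.I * a)).mul
      (continuous_csech_div ha)).aestronglyMeasurable
  · have h1 : Differentiable ℂ fun a ↦ (Complex.Gamma (Complex.I * a - x + 1))⁻¹ :=
      Complex.differentiable_one_div_Gamma.comp
        (by fun_prop : Differentiable ℂ fun a ↦ Complex.I * a - x + 1)
    have h2 : DifferentiableOn ℂ (fun a : ℂ ↦ (π * x / a : ℂ)) {a | 0 < a.re} :=
      (differentiableOn_const _).div differentiableOn_id fun a ha h ↦ by
        simp [show a = 0 from h] at ha
    have h3 : DifferentiableOn ℂ (fun a : ℂ ↦ csech (π * x / a)) {a | 0 < a.re} :=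
      (differentiableOn_const _).div (h2.cexp.add h2.neg.cexp)
        fun a ha ↦ exp_add_exp_neg_ne_zero ha x
    exact (h1.const_mul _).differentiableOn.mul h3
  · obtain ⟨C, c, hc, hC⟩ := exists_norm_csech_le hS hSU
    obtain ⟨B, hB⟩ := hS.isBounded.exists_norm_le
    obtain ⟨n, hn⟩ := exists_nat_ge B
    obtain ⟨D, hD⟩ := exists_norm_inv_Gamma_mul_le n ((Complex.I * ·) '' S)
      (hS.image (by fun_prop)) (by
        rintro _ ⟨a, ha, rfl⟩
        have h1 := (abs_le.1 (Complex.abs_re_le_norm (Complex.I * a))).1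
        rw [norm_mul, Complex.norm_I, one_mul] at h1
        have h2 := hB a ha
        linarith) (c / 2) (by positivity)
    refine ⟨fun x ↦ D * C * Real.exp (-(c / 2 * |x|)),
      (integrable_exp_neg_mul_abs (by positivity)).const_mul _, ae_of_all _ fun x a ha ↦ ?_⟩
    have h1 := hD _ ⟨a, ha, rfl⟩ x
    rw [norm_mul]
    refine (mul_le_mul h1 (hC a ha x) (norm_nonneg _) ((norm_nonneg _).trans h1)).trans
      (le_of_eq ?_)
    have : Real.exp (-(c / 2 * |x|)) = Real.exp (c / 2 * |x|) * Real.exp (-(c * |x|)) := by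
      rw [← Real.exp_add]; ring_nf
    simp only [this]
    ring

theorem binomKernel_half_mul_I {w : ℂ} {y : ℝ} (hy : y ∈ Set.Ioo (-π) π) :
    binomKernel w (w / 2) (y * Complex.I) =
      Complex.exp ((Real.log (2 * Real.cos (y / 2)) : ℝ) * w) := by
  have hcos : 0 < Real.cos (y / 2) :=
    Real.cos_pos_of_mem_Ioo ⟨by linarith [hy.1], by linarith [hy.2]⟩
  have him : ((y / 2 : ℂ) * Complex.I).im = y / 2 := by
    rw [← Complex.ofReal_ofNat, ← Complex.ofReal_div, Complex.im_ofReal_mul, Complex.I_im, mul_one]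
  rw [binomKernel, Complex.cpow_def_of_ne_zero
    (Complex.slitPlane_ne_zero (one_add_exp_mul_I_mem_slitPlane hy)), one_add_exp_mul_I,
    Complex.log_ofReal_mul (by positivity) (Complex.exp_ne_zero _),
    Complex.log_exp (by rw [him]; linarith [hy.1, Real.pi_pos])
      (by rw [him]; linarith [hy.2, Real.pi_pos]),
    ← Complex.exp_add]
  ring_nf

theorem exp_add_exp_neg_ofReal_ne_zero (x : ℝ) :
    Complex.exp x + Complex.exp (-x) ≠ 0 := by
  have : 0 < Real.exp x + Real.exp (-x) := by positivity
  exact_mod_cast this.ne'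

theorem integrableOn_one_add_exp_cpow {w : ℂ} (hw : 0 ≤ w.re) :
    IntegrableOn (fun y : ℝ ↦ (1 + Complex.exp (y * Complex.I)) ^ w) (Set.uIoc (-π) π) :=
  Measure.integrableOn_of_bounded (M := 2 ^ w.re * Real.exp (π * |w.im|))
    (by simp [Set.uIoc]) (Measurable.aestronglyMeasurable (by fun_prop))
    (ae_of_all _ fun y ↦ norm_one_add_exp_cpow_le hw (by simp))

theorem integral_one_add_exp_cpow_mul_csech (a : ℝ) :
    ∫ y in -π..π, (1 + Complex.exp (y * Complex.I)) ^ (Complex.I * a) * csech (a * y / 2) =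
      ∫ y in -π..π, binomKernel (Complex.I * a) (Complex.I * a / 2) (y * Complex.I) := by
  set w := Complex.I * a with hw
  set T : ℝ → ℂ := fun y ↦ (1 + Complex.exp (y * Complex.I)) ^ w * csech (a * y / 2) with hT
  have hTint : IntervalIntegrable T volume (-π) π := by
    refine IntervalIntegrable.mul_continuousOn ?_ (Continuous.continuousOn ?_)
    · exact intervalIntegrable_iff.2 (integrableOn_one_add_exp_cpow (by simp [hw]))
    · unfold csech
      refine continuous_const.div (by fun_prop) fun y ↦ ?_
      exact_mod_cast exp_add_exp_neg_ofReal_ne_zero (a * y / 2)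
  have hTneg : IntervalIntegrable (fun y ↦ T (-y)) volume (-π) π := by
    simpa using (IntervalIntegrable.iff_comp_neg (by finiteness)).1 hTint.symm
  have hneg : ∫ y in -π..π, T (-y) = ∫ y in -π..π, T y := by
    rw [intervalIntegral.integral_comp_neg, neg_neg]
  have hTeq : ∀ y ∈ Set.Ioo (-π) π, T y = Complex.exp ((Real.log (2 * Real.cos (y / 2)) : ℝ) * w) *
      (2 * Complex.exp (-(a * y / 2)) /
        (Complex.exp (a * y / 2) + Complex.exp (-(a * y / 2)))) := fun y hy ↦ by
    rw [← binomKernel_half_mul_I hy, binomKernel]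
    simp only [hT, csech]
    have : Complex.exp (-(w / 2 * (y * Complex.I))) * Complex.exp (-(a * y / 2)) = 1 := by
      rw [← Complex.exp_add, Complex.exp_eq_one_iff]
      exact ⟨0, by rw [hw]; linear_combination (-(a * y / 2 : ℂ)) * Complex.I_sq⟩
    linear_combination (-(1 + Complex.exp (y * Complex.I)) ^ w * (2 /
      (Complex.exp (a * y / 2) + Complex.exp (-(a * y / 2))))) * this
  have hsum : (∫ y in -π..π, T y) + ∫ y in -π..π, T (-y) =
      ∫ y in -π..π, 2 * binomKernel w (w / 2) (y * Complex.I) := by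
    rw [← intervalIntegral.integral_add hTint hTneg]
    refine intervalIntegral.integral_congr_ae ?_
    have hne : ∀ᵐ y : ℝ, y ≠ π := by simp [ae_iff]
    filter_upwards [hne] with y hy hy'
    rw [Set.uIoc_of_le (by linarith [Real.pi_pos])] at hy'
    have hyI : y ∈ Set.Ioo (-π) π := ⟨hy'.1, lt_of_le_of_ne hy'.2 hy⟩
    rw [hTeq y hyI, hTeq (-y) ⟨by linarith [hyI.2], by linarith [hyI.1]⟩,
      binomKernel_half_mul_I hyI, neg_div, Real.cos_neg, Complex.ofReal_neg, mul_neg, neg_div,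
      neg_neg, add_comm (Complex.exp (-(a * y / 2))), ← mul_add, ← add_div, ← mul_add,
      add_comm (Complex.exp (-(a * y / 2))), mul_div_cancel_right₀ _
        (by exact_mod_cast exp_add_exp_neg_ofReal_ne_zero (a * y / 2)), mul_comm]
  rw [hneg, intervalIntegral.integral_const_mul, ← two_mul] at hsum
  exact mul_left_cancel₀ two_ne_zero hsum

theorem integral_inv_Gamma_mul_csech_ofReal {a : ℝ} (ha : 0 < a) :
    ∫ x : ℝ, (Complex.Gamma (x + 1))⁻¹ * (Complex.Gamma (Complex.I * a - x + 1))⁻¹ *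
      csech (π * x / a) = a * (Complex.Gamma (Complex.I * a / 2 + 1))⁻¹ ^ 2 := by
  set w := Complex.I * a with hwdef
  have hw : 0 ≤ w.re := by simp [hwdef]
  have hG : Complex.Gamma (w + 1) ≠ 0 :=
    Complex.Gamma_ne_zero_of_re_pos (by simp [hwdef])
  have hpi : (π : ℂ) ≠ 0 := by exact_mod_cast Real.pi_ne_zero
  have hare : 0 < (a : ℂ).re := by simpa using ha
  have hsech : Integrable fun x : ℝ ↦ csech (π * x / a) := by
    obtain ⟨C, c, hc, hC⟩ := exists_norm_csech_le (isCompact_singleton (x := (a : ℂ))) (by simpa)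
    exact ((integrable_exp_neg_mul_abs hc).const_mul C).mono'
      (continuous_csech_div hare).aestronglyMeasurable (ae_of_all _ (hC a rfl))
  have hpow : Integrable (fun y : ℝ ↦ (1 + Complex.exp (y * Complex.I)) ^ w)
      (volume.restrict (Set.uIoc (-π) π)) :=
    integrableOn_one_add_exp_cpow hw
  have hprod : Integrable (Function.uncurry fun y x : ℝ ↦
      binomKernel w x (y * Complex.I) * csech (π * x / a))
      ((volume.restrict (Set.uIoc (-π) π)).prod volume) := by
    have hmeas : Measurable fun p : ℝ × ℝ ↦
        binomKernel w p.2 (p.1 * Complex.I) * csech (π * p.2 / a) := by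
      refine Measurable.mul ?_ ((continuous_csech_div hare).measurable.comp measurable_snd)
      unfold binomKernel
      fun_prop
    refine (hpow.mul_prod hsech).mono hmeas.aestronglyMeasurable (ae_of_all _ fun p ↦ ?_)
    simp [Function.uncurry, binomKernel, Complex.norm_exp]
  have hswap := intervalIntegral_integral_swap hprod
  simp only [intervalIntegral.integral_mul_const, integral_binomKernel hw] at hswap
  have hinner : ∀ y : ℝ, ∫ x : ℝ, binomKernel w x (y * Complex.I) * csech (π * x / a) =
      a * ((1 + Complex.exp (y * Complex.I)) ^ w * csech (a * y / 2)) := fun y ↦ by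
    rw [mul_left_comm, ← integral_csech_mul_exp ha, ← integral_const_mul]
    refine integral_congr_ae (ae_of_all _ fun x ↦ ?_)
    simp only [binomKernel]
    ring_nf
  simp only [hinner, intervalIntegral.integral_const_mul, mul_assoc, integral_const_mul] at hswap
  rw [integral_one_add_exp_cpow_mul_csech, integral_binomKernel hw,
    show w - w / 2 + 1 = w / 2 + 1 by ring] at hswap
  refine mul_left_cancel₀ (mul_ne_zero (mul_ne_zero two_ne_zero hpi) hG) ?_
  simp only [mul_assoc]
  rw [← hswap]
  ring

theorem integral_inv_Gamma_mul_csech {a : ℂ} (ha : 0 < a.re) :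
    ∫ x : ℝ, (Complex.Gamma (x + 1))⁻¹ * (Complex.Gamma (Complex.I * a - x + 1))⁻¹ *
      csech (π * x / a) = a * (Complex.Gamma (Complex.I * a / 2 + 1))⁻¹ ^ 2 := by
  have hopen : IsOpen {a : ℂ | 0 < a.re} := isOpen_lt continuous_const Complex.continuous_re
  have hright : Differentiable ℂ fun a : ℂ ↦
      a * (Complex.Gamma (Complex.I * a / 2 + 1))⁻¹ ^ 2 :=
    differentiable_id.mul ((Complex.differentiable_one_div_Gamma.comp
      (by fun_prop : Differentiable ℂ fun a ↦ Complex.I * a / 2 + 1)).pow 2)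
  refine AnalyticOnNhd.eqOn_of_preconnected_of_frequently_eq (z₀ := 1)
    (differentiableOn_integral_inv_Gamma_mul_csech.analyticOnNhd hopen)
    (fun z _ ↦ hright.analyticAt z) (convex_halfSpace_re_gt 0).isPreconnected (by simp) ?_ ha
  have hlim : Filter.Tendsto (fun t : ℝ ↦ (t : ℂ)) (nhdsWithin 1 {1}ᶜ) (nhdsWithin 1 {1}ᶜ) := by
    refine tendsto_nhdsWithin_iff.2 ⟨?_, ?_⟩
    · simpa using (Complex.continuous_ofReal.tendsto 1).mono_left nhdsWithin_le_nhds
    · filter_upwards [self_mem_nhdsWithin] with t ht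
      simpa using ht
  refine hlim.frequently (Filter.Eventually.frequently ?_)
  filter_upwards [mem_nhdsWithin_of_mem_nhds (Ioi_mem_nhds one_pos)] with t ht using
    integral_inv_Gamma_mul_csech_ofReal ht

theorem integral_binom_sech (α : ℂ) (hα : 0 < α.re) (hα' : -1 < α.im) :
    ∫ x : ℝ, cbinom (Complex.I * α) (x : ℂ) * csech (π * x / α) =
      α * (2 : ℂ) ^ (Complex.I * α) / (Real.sqrt π : ℂ) *
        (Complex.Gamma (Complex.I * α / 2 + 1 / 2) / Complex.Gamma (Complex.I * α / 2 + 1)) := by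
  have hG : Complex.Gamma (Complex.I * α / 2 + 1) ≠ 0 := by
    refine Complex.Gamma_ne_zero fun m h ↦ ?_
    have him := congr_arg Complex.im h
    have : (Complex.I * α / 2 + 1).im = α.re / 2 := by simp
    rw [this] at him
    simp at him
    linarith
  have hdup := Complex.Gamma_mul_Gamma_add_half (Complex.I * α / 2 + 1 / 2)
  have hpi : ((Real.sqrt π : ℝ) : ℂ) ≠ 0 := by
    exact_mod_cast (Real.sqrt_pos.2 Real.pi_pos).ne'
  rw [show Complex.I * α / 2 + 1 / 2 + 1 / 2 = Complex.I * α / 2 + 1 by ring,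
    show 2 * (Complex.I * α / 2 + 1 / 2) = Complex.I * α + 1 by ring,
    show 1 - (Complex.I * α + 1) = -(Complex.I * α) by ring, Complex.cpow_neg] at hdup
  have h2 : (2 : ℂ) ^ (Complex.I * α) ≠ 0 := by simp [Complex.cpow_eq_zero_iff]
  have hcongr : ∀ x : ℝ, cbinom (Complex.I * α) (x : ℂ) * csech (π * x / α) =
      Complex.Gamma (Complex.I * α + 1) * ((Complex.Gamma (x + 1))⁻¹ *
        (Complex.Gamma (Complex.I * α - x + 1))⁻¹ * csech (π * x / α)) := fun x ↦ by
    rw [cbinom, div_eq_mul_inv, mul_inv]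
    ring
  simp only [hcongr]
  rw [integral_const_mul, integral_inv_Gamma_mul_csech hα]
  generalize Complex.Gamma (Complex.I * α / 2 + 1) = G at hG hdup ⊢
  generalize Complex.Gamma (Complex.I * α / 2 + 1 / 2) = H at hdup ⊢
  generalize Complex.Gamma (Complex.I * α + 1) = F at hdup ⊢
  generalize (2 : ℂ) ^ (Complex.I * α) = p at h2 hdup ⊢
  field_simp at hdup ⊢
  linear_combination (-α) * hdup
end

section
/- Let w be a complex number with Re(w) > −1 and let z be any complex number. Then ∫_{−∞}^{∞} binom(w, x) · sinc(x − z) dx = binom(w, z). -/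
open scoped Real
open MeasureTheory

/-- The (normalized) sinc function on ℂ. -/
noncomputable def csinc (z : ℂ) : ℂ :=
  if z = 0 then 1 else Complex.sin (π * z) / (π * z)


open Filter Topology Set Complex

/-! ### The sinc kernel -/

lemma csinc_eq_integral (u : ℂ) :
    csinc u = (2 * π : ℂ)⁻¹ * ∫ s in Ioc (-π) π, cexp (I * u * (s : ℂ)) := by
  have hpi : (π : ℂ) ≠ 0 := by exact_mod_cast Real.pi_ne_zero
  rw [← intervalIntegral.integral_of_le (by linarith [Real.pi_pos])]
  by_cases hu : u = 0
  · simp only [hu, csinc]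
    simp
    rw [← two_mul]
    field_simp
  · rw [integral_exp_mul_complex (mul_ne_zero I_ne_zero hu), csinc, if_neg hu, Complex.sin]
    have h1 : I * u * (π : ℂ) = π * u * I := by ring
    have h2 : I * u * ((-π : ℝ) : ℂ) = -(π * u) * I := by push_cast; ring
    rw [h1, h2]
    field_simp
    rw [I_sq]
    ring

lemma measurable_csinc : Measurable csinc :=
  Measurable.ite (measurableSet_singleton 0) measurable_const (by fun_prop)

lemma norm_cexp_neg_I_mul_le (z : ℂ) {s : ℝ} (hs : s ∈ Ioc (-π) π) :
    ‖cexp (-(I * z * s))‖ ≤ Real.exp (π * |z.im|) := by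
  rw [Complex.norm_exp]
  refine Real.exp_le_exp.2 ?_
  have h : (-(I * z * s)).re = s * z.im := by simp; ring
  rw [h]
  calc s * z.im ≤ |s| * |z.im| := by rw [← abs_mul]; exact le_abs_self _
    _ ≤ π * |z.im| := by gcongr; exact abs_le.2 ⟨hs.1.le, hs.2⟩

lemma norm_csinc_le (x : ℝ) (z : ℂ) : ‖csinc (x - z)‖ ≤ Real.exp (π * |z.im|) := by
  have h := norm_setIntegral_le_of_norm_le_const (μ := volume) (s := Ioc (-π) π)
    (f := fun s : ℝ ↦ cexp (I * (x - z) * s)) (C := Real.exp (π * |z.im|)) (by simp) (by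
      intro s hs
      have h1 : I * (x - z) * s = ((x * s : ℝ) : ℂ) * I + -(I * z * s) := by push_cast; ring
      rw [h1, Complex.exp_add, norm_mul, Complex.norm_exp_ofReal_mul_I, one_mul]
      exact norm_cexp_neg_I_mul_le z hs)
  rw [csinc_eq_integral, norm_mul]
  rw [Real.volume_real_Ioc_of_le (by linarith [Real.pi_pos])] at h
  have h2 : ‖(2 * π : ℂ)⁻¹‖ = (2 * π)⁻¹ := by
    simp [abs_of_pos Real.pi_pos]
  rw [h2]
  have hp := Real.pi_pos
  rw [inv_mul_le_iff₀ (by positivity)]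
  linarith

lemma integral_csinc_mul_gaussian {b : ℝ} (hb : 0 < b) (z : ℂ) (t : ℝ) :
    ∫ x : ℝ, cexp (-(I * x * t)) * (csinc (x - z) * cexp (-b * (x : ℂ) ^ 2)) =
      ∫ s in Ioc (-π) π, ((2 * π : ℂ)⁻¹ * ((π / b) ^ (1 / 2 : ℂ) *
        cexp (-((s - t : ℝ) : ℂ) ^ 2 / (4 * b)))) * cexp (-(I * z * s)) := by
  have h1 (x : ℝ) : cexp (-(I * x * t)) * (csinc (x - z) * cexp (-b * (x : ℂ) ^ 2)) =
      ∫ s in Ioc (-π) π, (2 * π : ℂ)⁻¹ * (cexp (I * ((s - t : ℝ) : ℂ) * x) *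
        cexp (-b * (x : ℂ) ^ 2)) * cexp (-(I * z * s)) := by
    rw [csinc_eq_integral, ← integral_const_mul, ← integral_mul_const, ← integral_const_mul]
    congr 1 with s
    have : cexp (I * (x - z) * s) = cexp (I * x * s) * cexp (-(I * z * s)) := by
      rw [← Complex.exp_add]; ring_nf
    have h2 : cexp (I * ((s - t : ℝ) : ℂ) * x) = cexp (-(I * x * t)) * cexp (I * x * s) := by
      rw [← Complex.exp_add]; push_cast; ring_nf
    rw [this, h2]
    ring
  simp_rw [h1]
  rw [integral_integral_swap]
  · congr 1 with s
    rw [integral_mul_const, integral_const_mul, fourierIntegral_gaussian (by simpa using hb)]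
  · have hg : Integrable (fun x : ℝ ↦ Real.exp (-b * x ^ 2)) := integrable_exp_neg_mul_sq hb
    have hc : Integrable (fun _ : ℝ ↦ Real.exp (π * |z.im|)) (volume.restrict (Ioc (-π) π)) :=
      integrable_const _
    refine ((hg.mul_prod hc).const_mul (2 * π)⁻¹).mono'
      (Continuous.aestronglyMeasurable (by unfold Function.uncurry; fun_prop)) ?_
    have hm : ∀ᵐ p : ℝ × ℝ ∂(volume.prod (volume.restrict (Ioc (-π) π))), p.2 ∈ Ioc (-π) π :=
      Measure.quasiMeasurePreserving_snd.ae (ae_restrict_mem measurableSet_Ioc)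
    filter_upwards [hm] with p hp
    simp only [Function.uncurry, norm_mul]
    have e1 : ‖cexp (I * ((p.2 - t : ℝ) : ℂ) * p.1)‖ = 1 := by simp [Complex.norm_exp]
    have e2 : ‖cexp (-b * (p.1 : ℂ) ^ 2)‖ = Real.exp (-b * p.1 ^ 2) := by
      simp [Complex.norm_exp, ← Complex.ofReal_pow]
    have e3 : ‖(2 * π : ℂ)⁻¹‖ = (2 * π)⁻¹ := by simp [abs_of_pos Real.pi_pos]
    rw [e1, e2, e3, one_mul, mul_assoc]
    have := norm_cexp_neg_I_mul_le z hp
    gcongr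

/-- The centred Gaussian density on `ℝ` of variance `2 * b`. -/
noncomputable def gaussianKernel (b u : ℝ) : ℝ :=
  (2 * π)⁻¹ * (√(π / b) * Real.exp (-(4 * b)⁻¹ * u ^ 2))

lemma gaussianKernel_nonneg (b u : ℝ) : 0 ≤ gaussianKernel b u := by
  unfold gaussianKernel; positivity

lemma ofReal_gaussianKernel {b : ℝ} (hb : 0 < b) (u : ℝ) :
    (gaussianKernel b u : ℂ) =
      (2 * π : ℂ)⁻¹ * ((π / b) ^ (1 / 2 : ℂ) * cexp (-(u : ℂ) ^ 2 / (4 * b))) := by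
  have h : ((√(π / b) : ℝ) : ℂ) = (π / b : ℂ) ^ (1 / 2 : ℂ) := by
    rw [Real.sqrt_eq_rpow, Complex.ofReal_cpow (by positivity)]
    push_cast; rfl
  rw [gaussianKernel]
  push_cast
  rw [h]
  congr 3
  field_simp

lemma integrable_gaussianKernel_sub {b : ℝ} (hb : 0 < b) (t : ℝ) :
    Integrable (fun s ↦ gaussianKernel b (s - t)) :=
  (((integrable_exp_neg_mul_sq (b := (4 * b)⁻¹) (by positivity)).const_mul _).const_mul
    _).comp_sub_right t

lemma integral_gaussianKernel_sub {b : ℝ} (hb : 0 < b) (t : ℝ) :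
    ∫ s, gaussianKernel b (s - t) = 1 := by
  rw [integral_sub_right_eq_self (gaussianKernel b) t]
  unfold gaussianKernel
  rw [integral_const_mul, integral_const_mul, integral_gaussian, ← Real.sqrt_mul (by positivity)]
  have : π / b * (π / (4 * b)⁻¹) = (2 * π) ^ 2 := by field_simp; ring
  rw [this, Real.sqrt_sq (by positivity)]
  field_simp

lemma integral_csinc_mul_gaussian' {b : ℝ} (hb : 0 < b) (z : ℂ) (t : ℝ) :
    ∫ x : ℝ, cexp (-(I * x * t)) * (csinc (x - z) * cexp (-b * (x : ℂ) ^ 2)) =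
      ∫ s in Ioc (-π) π, (gaussianKernel b (s - t) : ℂ) * cexp (-(I * z * s)) := by
  rw [integral_csinc_mul_gaussian hb]
  simp_rw [← ofReal_gaussianKernel hb]

lemma norm_integral_csinc_mul_gaussian_le {b : ℝ} (hb : 0 < b) (z : ℂ) (t : ℝ) :
    ‖∫ x : ℝ, cexp (-(I * x * t)) * (csinc (x - z) * cexp (-b * (x : ℂ) ^ 2))‖ ≤
      Real.exp (π * |z.im|) := by
  rw [integral_csinc_mul_gaussian' hb]
  have hi := (integrable_gaussianKernel_sub hb t).mul_const (Real.exp (π * |z.im|))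
  calc _ ≤ ∫ s in Ioc (-π) π, gaussianKernel b (s - t) * Real.exp (π * |z.im|) := by
        refine norm_integral_le_of_norm_le hi.integrableOn ?_
        filter_upwards [ae_restrict_mem measurableSet_Ioc] with s hs
        rw [norm_mul, Complex.norm_of_nonneg (gaussianKernel_nonneg _ _)]
        have := norm_cexp_neg_I_mul_le z hs
        gcongr
        exact gaussianKernel_nonneg _ _
    _ ≤ ∫ s, gaussianKernel b (s - t) * Real.exp (π * |z.im|) :=
        setIntegral_le_integral hi (Eventually.of_forall fun s ↦
          mul_nonneg (gaussianKernel_nonneg _ _) (Real.exp_pos _).le)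
    _ = _ := by rw [integral_mul_const, integral_gaussianKernel_sub hb, one_mul]

lemma tendsto_integral_csinc_mul_gaussian (z : ℂ) {t : ℝ} (ht : t ∈ Ioo (-π) π) :
    Tendsto (fun c : ℝ ↦ ∫ x : ℝ, cexp (-(I * x * t)) *
        (csinc (x - z) * cexp (-((4 * π ^ 2 * c)⁻¹ : ℝ) * (x : ℂ) ^ 2)))
      atTop (𝓝 (cexp (-(I * z * t)))) := by
  have hf : Integrable (indicator (Ioc (-π) π) fun s : ℝ ↦ cexp (-(I * z * s))) :=
    (Continuous.integrableOn_Ioc (by fun_prop)).integrable_indicator measurableSet_Ioc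
  have hmem : Ioc (-π) π ∈ 𝓝 t := mem_of_superset (Ioo_mem_nhds ht.1 ht.2) Ioo_subset_Ioc_self
  have hc : ContinuousAt (indicator (Ioc (-π) π) fun s : ℝ ↦ cexp (-(I * z * s))) t := by
    refine ContinuousAt.congr (f := fun s : ℝ ↦ cexp (-(I * z * s))) (by fun_prop) ?_
    filter_upwards [hmem] with s hs
    rw [indicator_of_mem hs]
  have h := Real.tendsto_integral_gaussian_smul' hf hc
  rw [indicator_of_mem (Ioo_subset_Ioc_self ht)] at h
  refine h.congr' ?_
  filter_upwards [eventually_gt_atTop 0] with c hc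
  rw [integral_csinc_mul_gaussian (by positivity), ← integral_indicator measurableSet_Ioc]
  congr 1 with s
  by_cases hs : s ∈ Ioc (-π) π
  · rw [indicator_of_mem hs, indicator_of_mem hs, smul_eq_mul]
    congr 1
    rw [← ofReal_gaussianKernel (by positivity), gaussianKernel]
    have h1 : ((π * c : ℂ) ^ ((Module.finrank ℝ ℝ : ℂ) / 2)) = ((√(π * c) : ℝ) : ℂ) := by
      rw [Real.sqrt_eq_rpow, Complex.ofReal_cpow (by positivity)]
      simp
    have h2 : √(π / (4 * π ^ 2 * c)⁻¹) = 2 * π * √(π * c) := by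
      rw [← Real.sqrt_sq (by positivity : 0 ≤ 2 * π), ← Real.sqrt_mul (by positivity)]
      congr 1
      field_simp
      ring
    have h3 : -(4 * (4 * π ^ 2 * c)⁻¹)⁻¹ * (s - t) ^ 2 = -π ^ 2 * c * ‖t - s‖ ^ 2 := by
      rw [Real.norm_eq_abs, sq_abs]
      field_simp
      ring
    rw [h1, h2, h3]
    push_cast
    field_simp
  · rw [indicator_of_notMem hs, indicator_of_notMem hs, smul_zero]

/-- A Parseval formula: pairing the Fourier transform of an integrable function on `(-π, π]`
against a translate of `csinc` evaluates it. -/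
lemma integral_fourier_mul_csinc {F : ℝ → ℂ} (hF : IntegrableOn F (Ioc (-π) π)) (z : ℂ)
    (hint : Integrable fun x : ℝ ↦
      (∫ t in Ioc (-π) π, F t * cexp (-(I * x * t))) * csinc (x - z)) :
    ∫ x : ℝ, (∫ t in Ioc (-π) π, F t * cexp (-(I * x * t))) * csinc (x - z) =
      ∫ t in Ioc (-π) π, F t * cexp (-(I * z * t)) := by
  have hswap {b : ℝ} (hb : 0 < b) :
      ∫ x : ℝ, (∫ t in Ioc (-π) π, F t * cexp (-(I * x * t))) * csinc (x - z) *
        cexp (-b * (x : ℂ) ^ 2) =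
      ∫ t in Ioc (-π) π, F t *
        ∫ x : ℝ, cexp (-(I * x * t)) * (csinc (x - z) * cexp (-b * (x : ℂ) ^ 2)) := by
    simp_rw [← integral_const_mul, ← integral_mul_const]
    rw [integral_integral_swap]
    · simp_rw [mul_assoc]
    · have hg : Integrable (fun x : ℝ ↦ csinc (x - z) * cexp (-b * (x : ℂ) ^ 2)) := by
        refine (integrable_cexp_neg_mul_sq (b := b) (by simpa using hb)).bdd_mul
          (measurable_csinc.comp (by fun_prop)).aestronglyMeasurable
          (Eventually.of_forall fun x ↦ norm_csinc_le x z)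
      have h1 := (hg.mul_prod hF).bdd_mul (c := 1)
        (f := fun p : ℝ × ℝ ↦ cexp (-(I * p.1 * p.2)))
        (Continuous.aestronglyMeasurable (by fun_prop))
        (Eventually.of_forall fun p ↦ by simp [Complex.norm_exp])
      refine h1.congr (Eventually.of_forall fun p ↦ ?_)
      simp only [Function.uncurry]
      ring
  have hleft : Tendsto (fun c : ℝ ↦ ∫ x : ℝ,
      (∫ t in Ioc (-π) π, F t * cexp (-(I * x * t))) * csinc (x - z) *
        cexp (-((4 * π ^ 2 * c)⁻¹ : ℝ) * (x : ℂ) ^ 2)) atTop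
      (𝓝 (∫ x : ℝ, (∫ t in Ioc (-π) π, F t * cexp (-(I * x * t))) * csinc (x - z))) := by
    refine tendsto_integral_filter_of_dominated_convergence _ ?_ ?_ hint.norm ?_
    · exact Eventually.of_forall fun c ↦ hint.1.mul
        (Continuous.aestronglyMeasurable (by fun_prop))
    · filter_upwards [eventually_gt_atTop 0] with c hc
      refine Eventually.of_forall fun x ↦ ?_
      rw [norm_mul]
      refine mul_le_of_le_one_right (norm_nonneg _) ?_
      rw [Complex.norm_exp, Real.exp_le_one_iff]
      have : (-((4 * π ^ 2 * c)⁻¹ : ℝ) * (x : ℂ) ^ 2).re = -((4 * π ^ 2 * c)⁻¹ * x ^ 2) := by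
        norm_cast
        ring
      rw [this]
      have : 0 ≤ (4 * π ^ 2 * c)⁻¹ * x ^ 2 := by positivity
      linarith
    · refine Eventually.of_forall fun x ↦ ?_
      have h0 : Tendsto (fun c : ℝ ↦ (4 * π ^ 2 * c)⁻¹) atTop (𝓝 0) :=
        tendsto_inv_atTop_zero.comp (tendsto_id.const_mul_atTop (by positivity))
      have h1 : Continuous fun b : ℝ ↦
        (∫ t in Ioc (-π) π, F t * cexp (-(I * x * t))) * csinc (x - z) *
          cexp (-b * (x : ℂ) ^ 2) := by fun_prop
      have h2 := (h1.tendsto 0).comp h0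
      simp only [Complex.ofReal_zero, neg_zero, zero_mul, Complex.exp_zero, mul_one] at h2
      exact h2
  have hright : Tendsto (fun c : ℝ ↦ ∫ t in Ioc (-π) π, F t *
      ∫ x : ℝ, cexp (-(I * x * t)) *
        (csinc (x - z) * cexp (-((4 * π ^ 2 * c)⁻¹ : ℝ) * (x : ℂ) ^ 2))) atTop
      (𝓝 (∫ t in Ioc (-π) π, F t * cexp (-(I * z * t)))) := by
    refine tendsto_integral_filter_of_dominated_convergence
      (fun t ↦ ‖F t‖ * Real.exp (π * |z.im|)) ?_ ?_ (hF.norm.mul_const _) ?_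
    · refine Eventually.of_forall fun c ↦ hF.1.mul ?_
      have hm : StronglyMeasurable fun p : ℝ × ℝ ↦ cexp (-(I * p.2 * p.1)) *
          (csinc (p.2 - z) * cexp (-((4 * π ^ 2 * c)⁻¹ : ℝ) * (p.2 : ℂ) ^ 2)) := by
        refine Measurable.stronglyMeasurable ?_
        have := measurable_csinc.comp (f := fun p : ℝ × ℝ ↦ (p.2 : ℂ) - z) (by fun_prop)
        exact Measurable.mul (by fun_prop) (this.mul (by fun_prop))
      exact hm.integral_prod_right'.aestronglyMeasurable
    · filter_upwards [eventually_gt_atTop 0] with c hc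
      refine Eventually.of_forall fun t ↦ ?_
      rw [norm_mul]
      gcongr
      exact norm_integral_csinc_mul_gaussian_le (by positivity) z t
    · have hne : ∀ᵐ t ∂(volume.restrict (Ioc (-π) π)), t ≠ π :=
        ae_restrict_of_ae (Measure.ae_ne volume π)
      filter_upwards [ae_restrict_mem measurableSet_Ioc, hne] with t ht htne
      exact (tendsto_integral_csinc_mul_gaussian z
        ⟨ht.1, lt_of_le_of_ne ht.2 htne⟩).const_mul _
  refine tendsto_nhds_unique hleft (hright.congr' ?_)
  filter_upwards [eventually_gt_atTop 0] with c hc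
  exact (hswap (by positivity)).symm

/-! ### The Cauchy integral for the binomial coefficient -/

lemma tendsto_factorial_mul_cpow_div_Gamma (s : ℂ) :
    Tendsto (fun n : ℕ ↦ (n.factorial : ℂ) * (n : ℂ) ^ s / Gamma (s + n + 1)) atTop (𝓝 1) := by
  have hpos (s : ℂ) (hs : 0 < s.re) :
      Tendsto (fun n : ℕ ↦ (n.factorial : ℂ) * (n : ℂ) ^ s / Gamma (s + n + 1)) atTop (𝓝 1) := by
    have hG := Gamma_ne_zero_of_re_pos hs
    have hprod (n : ℕ) : Gamma (s + n) = Gamma s * ∏ j ∈ Finset.range n, (s + j) := by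
      induction n with
      | zero => simp
      | succ n ih =>
        have hne : s + n ≠ 0 := fun h ↦ by
          have := congrArg Complex.re h
          simp at this
          have : (0 : ℝ) ≤ n := n.cast_nonneg
          linarith
        rw [Finset.prod_range_succ, ← mul_assoc, ← ih, Nat.cast_succ, ← add_assoc,
          Gamma_add_one _ hne, mul_comm]
    have h := (GammaSeq_tendsto_Gamma s).div_const (Gamma s)
    rw [div_self hG] at h
    refine h.congr fun n ↦ ?_
    have := hprod (n + 1)
    rw [Nat.cast_succ, ← add_assoc] at this
    rw [this, GammaSeq, div_div]
    congr 1 <;> ring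
  have hdown (s : ℂ)
      (h : Tendsto (fun n : ℕ ↦ (n.factorial : ℂ) * (n : ℂ) ^ (s + 1) / Gamma (s + 1 + n + 1))
        atTop (𝓝 1)) :
      Tendsto (fun n : ℕ ↦ (n.factorial : ℂ) * (n : ℂ) ^ s / Gamma (s + n + 1)) atTop (𝓝 1) := by
    have h1 : Tendsto (fun n : ℕ ↦ (s + 1) * (n : ℂ)⁻¹ + 1) atTop (𝓝 1) := by
      simpa using (tendsto_inv_atTop_nhds_zero_nat (𝕜 := ℂ)).const_mul (s + 1) |>.add_const 1
    have h2 := h.mul h1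
    rw [mul_one] at h2
    refine h2.congr' ?_
    filter_upwards [eventually_ne_atTop 0] with n hn
    have hn' : (n : ℂ) ≠ 0 := Nat.cast_ne_zero.2 hn
    have h3 := one_div_Gamma_eq_self_mul_one_div_Gamma_add_one (s + n + 1)
    rw [show s + 1 + n + 1 = s + n + 1 + 1 by ring, div_eq_mul_inv, div_eq_mul_inv, h3,
      cpow_add _ _ hn', cpow_one]
    field_simp
    ring
  obtain ⟨k, hk⟩ := exists_nat_gt (-s.re)
  have hall (m : ℕ) : ∀ s : ℂ, 0 < s.re + m → Tendsto
      (fun n : ℕ ↦ (n.factorial : ℂ) * (n : ℂ) ^ s / Gamma (s + n + 1)) atTop (𝓝 1) := by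
    induction m with
    | zero => exact fun s hs ↦ hpos s (by simpa using hs)
    | succ m ih =>
      refine fun s hs ↦ hdown s (ih (s + 1) ?_)
      push_cast at hs
      simp
      linarith
  exact hall k s (by linarith)

lemma cbinom_add_two {w : ℂ} (hw : -1 < w.re) (b : ℂ) :
    cbinom (w + 2) ((w + 2) / 2 - b) * ((w + 2) ^ 2 / 4 - b ^ 2) =
      (w + 1) * (w + 2) * cbinom w (w / 2 - b) := by
  have h1 : w + 1 ≠ 0 := fun h ↦ by
    have := congrArg Complex.re h
    simp at this
    linarith
  have h2 : w + 1 + 1 ≠ 0 := fun h ↦ by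
    have := congrArg Complex.re h
    simp at this
    linarith
  have hβ := one_div_Gamma_eq_self_mul_one_div_Gamma_add_one (w / 2 - b + 1)
  have hγ := one_div_Gamma_eq_self_mul_one_div_Gamma_add_one (w / 2 + b + 1)
  simp only [cbinom, div_eq_mul_inv (Gamma _), mul_inv]
  rw [show (w + 2) / 2 - b + 1 = w / 2 - b + 1 + 1 by ring,
    show w + 2 - ((w + 2) / 2 - b) + 1 = w / 2 + b + 1 + 1 by ring,
    show w - (w / 2 - b) + 1 = w / 2 + b + 1 by ring,
    show w + 2 + 1 = w + 1 + 1 + 1 by ring, hβ, hγ, Gamma_add_one _ h2, Gamma_add_one _ h1]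
  ring

lemma tendsto_cbinom_div_cbinom (w b : ℂ) :
    Tendsto (fun n : ℕ ↦ cbinom (w + 2 * n) ((w + 2 * n) / 2 - b) / cbinom (2 * n) n)
      atTop (𝓝 (2 ^ w)) := by
  have hβ := tendsto_factorial_mul_cpow_div_Gamma (w / 2 - b)
  have hγ := tendsto_factorial_mul_cpow_div_Gamma (w / 2 + b)
  have h2n : Tendsto (fun n : ℕ ↦ 2 * n) atTop atTop := tendsto_id.const_mul_atTop' two_pos
  have hw := (tendsto_factorial_mul_cpow_div_Gamma w).comp h2n
  have h := ((hβ.mul hγ).div hw one_ne_zero).const_mul ((2 : ℂ) ^ w)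
  simp only [mul_one, div_one] at h
  refine h.congr' ?_
  filter_upwards [eventually_ne_atTop 0] with n hn
  have hn' : (n : ℂ) ≠ 0 := Nat.cast_ne_zero.2 hn
  simp only [Function.comp, cbinom, Pi.div_apply]
  have hpow : ((2 * n : ℕ) : ℂ) ^ w = 2 ^ w * ((n : ℂ) ^ (w / 2 - b) * (n : ℂ) ^ (w / 2 + b)) := by
    rw [← cpow_add _ _ hn', show w / 2 - b + (w / 2 + b) = w by ring, Nat.cast_mul,
      natCast_mul_natCast_cpow]
    norm_num
  rw [hpow, show (2 : ℂ) * n - n = n by ring, show (2 : ℂ) * n + 1 = ((2 * n : ℕ) : ℂ) + 1 by simp,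
    Gamma_nat_eq_factorial, Gamma_nat_eq_factorial,
    show w / 2 - b + n + 1 = (w + 2 * n) / 2 - b + 1 by ring,
    show w / 2 + b + n + 1 = w + 2 * n - ((w + 2 * n) / 2 - b) + 1 by ring]
  have h1 : (n : ℂ) ^ (w / 2 - b) ≠ 0 := by simp [cpow_eq_zero_iff, hn']
  have h2 : (n : ℂ) ^ (w / 2 + b) ≠ 0 := by simp [cpow_eq_zero_iff, hn']
  have h3 : (2 : ℂ) ^ w ≠ 0 := by simp [cpow_eq_zero_iff]
  have h4 : (n.factorial : ℂ) ≠ 0 := Nat.cast_ne_zero.2 n.factorial_ne_zero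
  have h5 : ((2 * n).factorial : ℂ) ≠ 0 := Nat.cast_ne_zero.2 (2 * n).factorial_ne_zero
  generalize (n : ℂ) ^ (w / 2 - b) = p at *
  generalize (n : ℂ) ^ (w / 2 + b) = q at *
  simp only [div_eq_mul_inv, mul_inv, inv_inv]
  generalize (Gamma ((w + 2 * n) * 2⁻¹ - b + 1))⁻¹ = G
  generalize (Gamma (w + 2 * n - ((w + 2 * n) * 2⁻¹ - b) + 1))⁻¹ = H
  push_cast
  field_simp

lemma two_mul_cos_half_pos {t : ℝ} (ht : t ∈ Ioo (-π) π) : 0 < 2 * Real.cos (t / 2) := by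
  have := Real.cos_pos_of_mem_Ioo (x := t / 2) ⟨by linarith [ht.1], by linarith [ht.2]⟩
  positivity

lemma one_sub_abs_div_pi_le_cos_half {t : ℝ} (ht : t ∈ Ioo (-π) π) :
    1 - |t| / π ≤ Real.cos (t / 2) := by
  have h := Real.one_sub_mul_le_cos (x := |t| / 2) (by positivity)
    (by linarith [(abs_lt.2 ht).le])
  have h2 : Real.cos (|t| / 2) = Real.cos (t / 2) := by
    rw [← Real.cos_abs (t / 2), abs_div, abs_two]
  rw [h2] at h
  calc _ = 1 - 2 / π * (|t| / 2) := by ring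
    _ ≤ _ := h

/-- The integrand `(2 cos (t / 2)) ^ w * exp (i b t)` of Cauchy's integral. -/
noncomputable def cosKernel (w b : ℂ) (t : ℝ) : ℂ :=
  ((2 * Real.cos (t / 2) : ℝ) : ℂ) ^ w * cexp (I * b * t)

lemma two_mul_cos_half_rpow_le (r : ℝ) {t : ℝ} (ht : t ∈ Ioo (-π) π) :
    (2 * Real.cos (t / 2)) ^ r ≤
      2 ^ r + (2 / π) ^ r * ((π - t) ^ r + (π + t) ^ r) := by
  have hp := Real.pi_pos
  have hC := two_mul_cos_half_pos ht
  have h1 : 0 < π - t := by linarith [ht.2]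
  have h2 : 0 < π + t := by linarith [ht.1]
  rcases le_total 0 r with hr | hr
  · have : (2 * Real.cos (t / 2)) ^ r ≤ 2 ^ r :=
      Real.rpow_le_rpow hC.le (by linarith [Real.cos_le_one (t / 2)]) hr
    have : 0 ≤ (2 / π) ^ r * ((π - t) ^ r + (π + t) ^ r) := by positivity
    linarith
  · have h3 : 0 < π - |t| := by linarith [abs_lt.2 ht]
    have h4 : 2 / π * (π - |t|) ≤ 2 * Real.cos (t / 2) := by
      have := one_sub_abs_div_pi_le_cos_half ht
      calc _ = 2 * (1 - |t| / π) := by field_simp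
        _ ≤ _ := by linarith
    have h5 := Real.rpow_le_rpow_of_nonpos (by positivity) h4 hr
    rw [Real.mul_rpow (by positivity) h3.le] at h5
    have h6 : (π - |t|) ^ r ≤ (π - t) ^ r + (π + t) ^ r := by
      have := Real.rpow_nonneg h1.le r
      have := Real.rpow_nonneg h2.le r
      rcases abs_cases t with ⟨h, _⟩ | ⟨h, _⟩ <;> rw [h]
      · linarith
      · rw [sub_neg_eq_add]; linarith
    have h7 : (2 / π) ^ r * (π - |t|) ^ r ≤ (2 / π) ^ r * ((π - t) ^ r + (π + t) ^ r) := by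
      gcongr
    have : (0 : ℝ) ≤ 2 ^ r := by positivity
    linarith

lemma measurable_cosKernel (w b : ℂ) : Measurable (cosKernel w b) := by
  unfold cosKernel
  have : Measurable fun t : ℝ ↦ ((2 * Real.cos (t / 2) : ℝ) : ℂ) := by fun_prop
  exact (this.pow_const w).mul (by fun_prop)

lemma intervalIntegrable_cosKernel {w : ℂ} (hw : -1 < w.re) (b : ℂ) :
    IntervalIntegrable (cosKernel w b) volume (-π) π := by
  have hp := Real.pi_pos
  have hsub : IntervalIntegrable (fun t : ℝ ↦ (π - t) ^ w.re) volume (-π) π := by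
    have h := (intervalIntegral.intervalIntegrable_rpow' hw (a := 2 * π) (b := 0)).comp_sub_left π
    rwa [sub_zero, show π - 2 * π = -π by ring] at h
  have hadd : IntervalIntegrable (fun t : ℝ ↦ (π + t) ^ w.re) volume (-π) π := by
    have h := (intervalIntegral.intervalIntegrable_rpow' hw (a := 0) (b := 2 * π)).comp_add_left π
    rwa [zero_sub, show 2 * π - π = π by ring] at h
  have hbd : IntervalIntegrable (fun t : ℝ ↦ (2 ^ w.re + (2 / π) ^ w.re *
      ((π - t) ^ w.re + (π + t) ^ w.re)) * Real.exp (π * |b.im|)) volume (-π) π :=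
    ((intervalIntegrable_const).add ((hsub.add hadd).const_mul _)).mul_const _
  refine hbd.mono_fun' (measurable_cosKernel w b).aestronglyMeasurable ?_
  rw [uIoc_of_le (by linarith)]
  have hne : ∀ᵐ t ∂(volume.restrict (Ioc (-π) π)), t ≠ π :=
    ae_restrict_of_ae (Measure.ae_ne volume π)
  filter_upwards [ae_restrict_mem measurableSet_Ioc, hne] with t ht htne
  have ht' : t ∈ Ioo (-π) π := ⟨ht.1, lt_of_le_of_ne ht.2 htne⟩
  rw [cosKernel, norm_mul, norm_cpow_eq_rpow_re_of_pos (two_mul_cos_half_pos ht')]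
  have h1 := norm_cexp_neg_I_mul_le (-b) ht
  rw [neg_im, abs_neg, mul_neg, neg_mul, neg_neg] at h1
  have h2 := two_mul_cos_half_rpow_le w.re ht'
  have h3 := Real.rpow_nonneg (two_mul_cos_half_pos ht').le w.re
  exact mul_le_mul h2 h1 (norm_nonneg _) (h3.trans h2)

lemma continuous_ofReal_two_mul_cos_half : Continuous fun t : ℝ ↦
    ((2 * Real.cos (t / 2) : ℝ) : ℂ) := by fun_prop

lemma integral_cosKernel_add_two {w : ℂ} (hw : -1 < w.re) (b : ℂ) :
    (∫ t in (-π)..π, cosKernel (w + 2) b t) * ((w + 2) ^ 2 / 4 - b ^ 2) =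
      (w + 1) * (w + 2) * ∫ t in (-π)..π, cosKernel w b t := by
  have hp := Real.pi_pos
  set C : ℝ → ℂ := fun t ↦ ((2 * Real.cos (t / 2) : ℝ) : ℂ) with hC
  set G : ℝ → ℂ := fun t ↦ (-(w + 2) * C t ^ (w + 1) * (Real.sin (t / 2) : ℂ) -
    I * b * C t ^ (w + 2)) * cexp (I * b * t) with hG
  have hpow (v : ℂ) (hv : 0 < v.re) : ContinuousOn (fun t ↦ C t ^ v) (Icc (-π) π) := by
    intro t ht
    have h0 : 0 ≤ (C t).re := by
      rw [hC, ofReal_re]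
      have := Real.cos_nonneg_of_mem_Icc (x := t / 2) ⟨by linarith [ht.1], by linarith [ht.2]⟩
      positivity
    exact ((continuousAt_cpow_const_of_re_pos (Or.inl h0) hv).comp
      continuous_ofReal_two_mul_cos_half.continuousAt).continuousWithinAt
  have hcont : ContinuousOn G (Icc (-π) π) := by
    have h1 := hpow (w + 1) (by simp; linarith)
    have h2 := hpow (w + 2) (by simp; linarith)
    rw [hG]
    refine ContinuousOn.mul ?_ (by fun_prop)
    refine ContinuousOn.sub ?_ ?_
    · exact (continuousOn_const.mul h1).mul (by fun_prop)
    · exact continuousOn_const.mul h2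
  have hderiv : ∀ t ∈ Ioo (-π) π, HasDerivAt G ((w + 1) * (w + 2) * cosKernel w b t -
      ((w + 2) ^ 2 / 4 - b ^ 2) * cosKernel (w + 2) b t) t := by
    intro t ht
    have hpos := two_mul_cos_half_pos ht
    have hslit : C t ∈ slitPlane := ofReal_mem_slitPlane.2 hpos
    have hne : C t ≠ 0 := slitPlane_ne_zero hslit
    have hCc : HasDerivAt C (-(Real.sin (t / 2) : ℂ)) t := by
      have h : HasDerivAt (fun t : ℝ ↦ 2 * Real.cos (t / 2)) (-Real.sin (t / 2)) t := by
        convert! (((hasDerivAt_id t).div_const 2).cos).const_mul 2 using 1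
        simp; ring
      exact_mod_cast h.ofReal_comp
    have hS : HasDerivAt (fun t : ℝ ↦ (Real.sin (t / 2) : ℂ)) (C t / 4) t := by
      have h : HasDerivAt (fun t : ℝ ↦ Real.sin (t / 2)) (2 * Real.cos (t / 2) / 4) t := by
        convert! ((hasDerivAt_id t).div_const 2).sin using 1
        simp; ring
      simpa [hC] using h.ofReal_comp
    have hE : HasDerivAt (fun t : ℝ ↦ cexp (I * b * t)) (cexp (I * b * t) * (I * b)) t := by
      have h : HasDerivAt (fun u : ℂ ↦ I * b * u) (I * b) (t : ℂ) := by
        simpa using (hasDerivAt_id (t : ℂ)).const_mul (I * b)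
      exact h.cexp.comp_ofReal
    have hP (v : ℂ) : HasDerivAt (fun t ↦ C t ^ v)
        (v * C t ^ (v - 1) * -(Real.sin (t / 2) : ℂ)) t :=
      ((hasStrictDerivAt_cpow_const hslit).hasDerivAt).comp t hCc
    have h := ((((hP (w + 1)).const_mul (-(w + 2))).mul hS).sub
      ((hP (w + 2)).const_mul (I * b))).mul hE
    refine h.congr_deriv ?_
    have e1 : C t ^ (w + 1) = C t ^ w * C t := by rw [cpow_add _ _ hne, cpow_one]
    have e2 : C t ^ (w + 2) = C t ^ w * C t ^ 2 := by
      rw [cpow_add _ _ hne, show (2 : ℂ) = ((2 : ℕ) : ℂ) by norm_num, cpow_natCast]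
    have hs : (Real.sin (t / 2) : ℂ) ^ 2 = 1 - C t ^ 2 / 4 := by
      have := Real.sin_sq (t / 2)
      simp only [hC]
      norm_cast
      rw [this]
      ring
    simp only [cosKernel, Pi.mul_apply, Pi.sub_apply]
    rw [show w + 1 - 1 = w by ring, show w + 2 - 1 = w + 1 by ring]
    change _ = (w + 1) * (w + 2) * (C t ^ w * _) - _ * (C t ^ (w + 2) * _)
    rw [e1, e2]
    linear_combination (C t ^ w * cexp (I * b * t)) * (w + 1) * (w + 2) * hs -
      b ^ 2 * C t ^ w * C t ^ 2 * cexp (I * b * t) * I_sq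
  have hi0 := (intervalIntegrable_cosKernel hw b).const_mul ((w + 1) * (w + 2))
  have hi2 := (intervalIntegrable_cosKernel (w := w + 2) (by simp; linarith) b).const_mul
    ((w + 2) ^ 2 / 4 - b ^ 2)
  have h := intervalIntegral.integral_eq_sub_of_hasDerivAt_of_le (by linarith) hcont hderiv
    (hi0.sub hi2)
  have hw1 : w + 1 ≠ 0 := fun h ↦ by
    have := congrArg Complex.re h
    simp at this
    linarith
  have hw2 : w + 2 ≠ 0 := fun h ↦ by
    have := congrArg Complex.re h
    simp at this
    linarith
  have hC1 : C π = 0 := by simp [hC]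
  have hC2 : C (-π) = 0 := by simp [hC, neg_div]
  rw [intervalIntegral.integral_sub hi0 hi2, intervalIntegral.integral_const_mul,
    intervalIntegral.integral_const_mul] at h
  simp only [hG, hC1, hC2, zero_cpow hw1, zero_cpow hw2] at h
  linear_combination -h

lemma tendsto_integral_cosKernel {w : ℂ} (hw : -1 < w.re) (b : ℂ) :
    Tendsto (fun n : ℕ ↦ (∫ t in (-π)..π, cosKernel (w + 2 * n) b t) /
      ((∫ t in Icc (-π) π, ((2 * Real.cos (t / 2)) ^ 2) ^ n : ℝ) : ℂ)) atTop (𝓝 (2 ^ w)) := by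
  have hp := Real.pi_pos
  have hle : -π ≤ π := by linarith
  have hcont : ContinuousWithinAt (cosKernel w b) (Icc (-π) π) 0 := by
    refine ContinuousAt.continuousWithinAt ?_
    unfold cosKernel
    refine ContinuousAt.mul ?_ (by fun_prop)
    refine ContinuousAt.cpow continuous_ofReal_two_mul_cos_half.continuousAt continuousAt_const ?_
    simp
  have h := tendsto_setIntegral_pow_smul_of_unique_maximum_of_isCompact_of_integrableOn
    (μ := volume) (isCompact_Icc (a := -π) (b := π)) (x₀ := 0)
    (c := fun t : ℝ ↦ (2 * Real.cos (t / 2)) ^ 2) (g := cosKernel w b)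
    (by fun_prop) ?_ (fun _ _ ↦ by positivity) (by simp) ?_ ?_ hcont
  · have h0 : cosKernel w b 0 = 2 ^ w := by simp [cosKernel]
    rw [h0] at h
    refine h.congr fun n ↦ ?_
    rw [intervalIntegral.integral_of_le hle, div_eq_inv_mul, ← ofReal_inv, real_smul,
      integral_Ioc_eq_integral_Ioo, integral_Icc_eq_integral_Ioo (f := fun t ↦ _ • cosKernel w b t)]
    congr 1
    refine setIntegral_congr_fun measurableSet_Ioo fun t ht ↦ ?_
    have hpos := two_mul_cos_half_pos ht
    simp only [cosKernel, real_smul]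
    rw [cpow_add _ _ (ofReal_ne_zero.2 hpos.ne'), show (2 * n : ℂ) = ((2 * n : ℕ) : ℂ) by simp,
      cpow_natCast, pow_mul]
    push_cast
    ring
  · intro t ht htne
    have h1 : 0 ≤ Real.cos (t / 2) :=
      Real.cos_nonneg_of_mem_Icc ⟨by linarith [ht.1], by linarith [ht.2]⟩
    have h2 : Real.cos (t / 2) < 1 := by
      refine lt_of_le_of_ne (Real.cos_le_one _) fun h ↦ htne ?_
      have := (Real.cos_eq_one_iff_of_lt_of_lt (by linarith [ht.1]) (by linarith [ht.2])).1 h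
      linarith
    simp only [zero_div, Real.cos_zero]
    nlinarith
  · rw [interior_Icc, closure_Ioo (by linarith)]
    exact ⟨by linarith, hp.le⟩
  · rw [integrableOn_Icc_iff_integrableOn_Ioc, ← intervalIntegrable_iff_integrableOn_Ioc_of_le hle]
    exact intervalIntegrable_cosKernel hw b

/-- Cauchy's integral representation of the binomial coefficient. -/
theorem integral_cosKernel {w : ℂ} (hw : -1 < w.re) (b : ℂ) :
    ∫ t in (-π)..π, cosKernel w b t = 2 * π * cbinom w (w / 2 - b) := by
  have hscale {w : ℂ} (hw : -1 < w.re) (b : ℂ) (n : ℕ) : ∃ q : ℂ,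
      (∫ t in (-π)..π, cosKernel w b t) = q * ∫ t in (-π)..π, cosKernel (w + 2 * n) b t ∧
      cbinom w (w / 2 - b) = q * cbinom (w + 2 * n) ((w + 2 * n) / 2 - b) := by
    induction n with
    | zero => exact ⟨1, by simp, by simp⟩
    | succ n ih =>
      obtain ⟨q, h1, h2⟩ := ih
      have hre : -1 < (w + 2 * n).re := by
        have : (0 : ℝ) ≤ n := n.cast_nonneg
        simp
        linarith
      have hne1 : w + 2 * n + 1 ≠ 0 := fun h ↦ by
        have := congrArg Complex.re h
        simp at this hre
        linarith
      have hne2 : w + 2 * n + 2 ≠ 0 := fun h ↦ by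
        have := congrArg Complex.re h
        simp at this hre
        linarith
      have h3 := integral_cosKernel_add_two hre b
      have h4 := cbinom_add_two hre b
      have hsucc : w + 2 * ((n + 1 : ℕ) : ℂ) = w + 2 * n + 2 := by push_cast; ring
      refine ⟨q * ((w + 2 * n + 2) ^ 2 / 4 - b ^ 2) / ((w + 2 * n + 1) * (w + 2 * n + 2)), ?_, ?_⟩
      · rw [h1, hsucc]
        field_simp
        linear_combination -4 * q * h3
      · rw [h2, hsucc]
        generalize cbinom (w + 2 * n + 2) ((w + 2 * n + 2) / 2 - b) = x at *
        generalize cbinom (w + 2 * n) ((w + 2 * n) / 2 - b) = y at *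
        field_simp
        linear_combination -4 * q * h4
  have hcentral (n : ℕ) :
      ∫ t in (-π)..π, cosKernel (2 * n) 0 t = 2 * π * cbinom (2 * n) n := by
    obtain ⟨q, h1, h2⟩ := hscale (w := 0) (by simp) 0 n
    have h3 : ∫ t in (-π)..π, cosKernel 0 0 t = 2 * π := by simp [cosKernel]; ring
    have h4 : cbinom 0 (0 / 2 - 0) = 1 := by simp [cbinom]
    rw [h3, zero_add] at h1
    rw [h4, zero_add, show (2 * n : ℂ) / 2 - 0 = n by ring] at h2
    have hq : q ≠ 0 := fun h ↦ by simp [h] at h2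
    apply mul_left_cancel₀ hq
    linear_combination -h1 + 2 * π * h2
  have h0 := tendsto_integral_cosKernel (w := 0) (by simp) 0
  have hK := (tendsto_integral_cosKernel hw b).div h0 (by simp)
  have hB := tendsto_cbinom_div_cbinom w b
  have hratio : Tendsto (fun n : ℕ ↦ (∫ t in (-π)..π, cosKernel (w + 2 * n) b t) /
      (2 * π * cbinom (2 * n) n)) atTop (𝓝 (2 ^ w)) := by
    rw [cpow_zero, div_one] at hK
    refine hK.congr' ?_
    filter_upwards [h0.eventually_ne (cpow_ne_zero_iff.2 (Or.inl two_ne_zero))] with n hn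
    have hk := (div_ne_zero_iff.1 hn).2
    rw [Pi.div_apply, div_div_div_cancel_right₀ hk, zero_add, hcentral]
  have hpi : (π : ℂ) ≠ 0 := ofReal_ne_zero.2 Real.pi_ne_zero
  have hlim := (hB.const_mul (∫ t in (-π)..π, cosKernel w b t)).congr
    (f₂ := fun n : ℕ ↦ 2 * π * cbinom w (w / 2 - b) *
      ((∫ t in (-π)..π, cosKernel (w + 2 * n) b t) / (2 * π * cbinom (2 * n) n))) fun n ↦ by
    obtain ⟨q, h1, h2⟩ := hscale hw b n
    rw [h1, h2]
    field_simp
  exact mul_right_cancel₀ (cpow_ne_zero_iff.2 (Or.inl two_ne_zero))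
    (tendsto_nhds_unique hlim (hratio.const_mul _))

lemma cbinom_eq_integral {w : ℂ} (hw : -1 < w.re) (z : ℂ) :
    cbinom w z = ∫ t in Ioc (-π) π, (2 * π : ℂ)⁻¹ * cosKernel w (w / 2) t *
      cexp (-(I * z * t)) := by
  have h := integral_cosKernel hw (w / 2 - z)
  have hpi : (π : ℂ) ≠ 0 := ofReal_ne_zero.2 Real.pi_ne_zero
  rw [sub_sub_cancel, intervalIntegral.integral_of_le (by linarith [Real.pi_pos])] at h
  simp_rw [mul_assoc ((2 * π : ℂ)⁻¹)]
  rw [integral_const_mul, eq_inv_mul_iff_mul_eq₀ (by simp [hpi]), ← h]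
  congr 1 with t
  rw [cosKernel, cosKernel, mul_assoc (_ ^ w), ← Complex.exp_add]
  ring_nf

/-! ### Decay of the binomial coefficient along the real line -/

lemma cbinom_mul_self (w x : ℂ) : cbinom w x * x = (w - x + 1) * cbinom w (x - 1) := by
  have h1 := one_div_Gamma_eq_self_mul_one_div_Gamma_add_one x
  have h2 := one_div_Gamma_eq_self_mul_one_div_Gamma_add_one (w - x + 1)
  simp only [cbinom, div_eq_mul_inv (Gamma _), mul_inv]
  rw [sub_add_cancel, show w - (x - 1) + 1 = w - x + 1 + 1 by ring, h1, h2]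
  ring

lemma continuous_cbinom (w : ℂ) : Continuous (cbinom w) := by
  have h : cbinom w = fun z ↦ Gamma (w + 1) * ((Gamma (z + 1))⁻¹ * (Gamma (w - z + 1))⁻¹) := by
    ext z
    rw [cbinom, div_eq_mul_inv, mul_inv]
  have hc := differentiable_one_div_Gamma.continuous
  rw [h]
  exact continuous_const.mul ((hc.comp (by fun_prop)).mul (hc.comp (by fun_prop)))

/-- A continuous function contracting by `1 - c / x` on unit steps decays like `x ^ (-c)`. -/
lemma exists_forall_mul_rpow_le {g : ℝ → ℝ} (hg : Continuous g) (hg0 : ∀ x, 0 ≤ g x) {c R : ℝ}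
    (hc0 : 0 < c) (hc1 : c ≤ 1) (hR : 2 ≤ R) (hstep : ∀ x, R ≤ x → g x ≤ (1 - c / x) * g (x - 1)) :
    ∃ K, 0 ≤ K ∧ ∀ x, 0 ≤ x → g x * (1 + x) ^ c ≤ K := by
  have hcont : Continuous fun x ↦ g x * (1 + |x|) ^ c :=
    hg.mul ((continuous_const.add continuous_abs).rpow_const fun _ ↦ Or.inr hc0.le)
  obtain ⟨K, hK⟩ := (isCompact_Icc (a := (0 : ℝ)) (b := R)).bddAbove_image hcont.continuousOn
  have hKx (x : ℝ) (h0 : 0 ≤ x) (hx : x ≤ R) : g x * (1 + x) ^ c ≤ K := by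
    have := hK (mem_image_of_mem _ ⟨h0, hx⟩)
    simpa [abs_of_nonneg h0] using this
  have hind (n : ℕ) : ∀ x, 0 ≤ x → x ≤ R + n → g x * (1 + x) ^ c ≤ K := by
    induction n with
    | zero => intro x h0 hx; exact hKx x h0 (by simpa using hx)
    | succ n ih =>
      intro x h0 hx
      rcases le_total x R with h | h
      · exact hKx x h0 h
      have hxp : 0 < x := by linarith
      push_cast at hx
      refine le_trans ?_ (ih (x - 1) (by linarith) (by linarith))
      have h1 : (1 + x) ^ c ≤ (1 + c / x) * x ^ c := by
        have h2 : (1 + x) = (1 + 1 / x) * x := by field_simp; ring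
        rw [h2, Real.mul_rpow (by positivity) hxp.le]
        gcongr
        have := rpow_one_add_le_one_add_mul_self (s := 1 / x) (p := c)
          (by have : 0 ≤ 1 / x := by positivity
              linarith) hc0.le hc1
        calc _ ≤ _ := this
          _ = _ := by ring
      have h3 : 0 ≤ 1 - c / x := by
        rw [sub_nonneg, div_le_one hxp]; linarith
      calc g x * (1 + x) ^ c
          ≤ ((1 - c / x) * g (x - 1)) * ((1 + c / x) * x ^ c) :=
            mul_le_mul (hstep x h) h1 (by positivity) (mul_nonneg h3 (hg0 _))
        _ = (1 - (c / x) ^ 2) * (g (x - 1) * x ^ c) := by ring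
        _ ≤ 1 * (g (x - 1) * x ^ c) := by
            have := hg0 (x - 1)
            gcongr
            linarith [sq_nonneg (c / x)]
        _ = g (x - 1) * (1 + (x - 1)) ^ c := by rw [one_mul, add_sub_cancel]
  refine ⟨K, le_trans (mul_nonneg (hg0 0) (by positivity)) (hKx 0 le_rfl (by linarith)), ?_⟩
  intro x hx
  obtain ⟨n, hn⟩ := exists_nat_gt x
  exact hind n x hx (by linarith)

lemma norm_cbinom_le_step {w : ℂ} {c : ℝ} (hc0 : 0 < c) (hc : c < w.re + 1) :
    ∃ R, 2 ≤ R ∧ ∀ x : ℝ, R ≤ x → ‖cbinom w x‖ ≤ (1 - c / x) * ‖cbinom w (x - 1 : ℝ)‖ := by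
  set d := w.re + 1 - c with hd
  have hdp : 0 < d := by linarith
  refine ⟨max (2 + c) (‖w + 1‖ ^ 2 / (2 * d)), le_max_of_le_left (by linarith), fun x hx ↦ ?_⟩
  have hx1 : 2 + c ≤ x := (le_max_left _ _).trans hx
  have hx2 : ‖w + 1‖ ^ 2 / (2 * d) ≤ x := (le_max_right _ _).trans hx
  have hxp : 0 < x := by linarith
  rw [div_le_iff₀ (by positivity)] at hx2
  have h := congrArg norm (cbinom_mul_self w x)
  rw [norm_mul, norm_mul, norm_real, Real.norm_of_nonneg hxp.le] at h
  have h1 : ‖w - x + 1‖ ≤ x - c := by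
    refine abs_le_of_sq_le_sq' ?_ (by linarith) |>.2
    rw [Complex.sq_norm, normSq_apply]
    rw [Complex.sq_norm, normSq_apply] at hx2
    simp at hx2 ⊢
    nlinarith
  rw [← sub_nonneg] at h1
  have h2 : ‖cbinom w x‖ * x ≤ ((1 - c / x) * ‖cbinom w (x - 1 : ℝ)‖) * x := by
    rw [h]
    push_cast
    have : (1 - c / x) * ‖cbinom w (x - 1)‖ * x = (x - c) * ‖cbinom w (x - 1)‖ := by field_simp
    rw [this]
    have := norm_nonneg (cbinom w (x - 1))
    nlinarith
  exact le_of_mul_le_mul_right h2 hxp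

lemma norm_cbinom_neg_le_step {w : ℂ} {c : ℝ} (hc0 : 0 < c) (hc : c < w.re + 1) :
    ∃ R, 2 ≤ R ∧ ∀ x : ℝ, R ≤ x →
      ‖cbinom w (-x : ℝ)‖ ≤ (1 - c / x) * ‖cbinom w (-(x - 1) : ℝ)‖ := by
  set d := w.re + 1 - c with hd
  have hdp : 0 < d := by linarith
  refine ⟨max (2 + c) (max (1 - w.re) (c * w.re / d)), le_max_of_le_left (by linarith),
    fun x hx ↦ ?_⟩
  have hx1 : 2 + c ≤ x := (le_max_left _ _).trans hx
  have hx2 : 1 - w.re ≤ x := (le_max_left _ _).trans ((le_max_right _ _).trans hx)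
  have hx3 : c * w.re / d ≤ x := (le_max_right _ _).trans ((le_max_right _ _).trans hx)
  have hxp : 0 < x := by linarith
  rw [div_le_iff₀ hdp] at hx3
  have h := congrArg norm (cbinom_mul_self w (-(x - 1) : ℝ))
  have e1 : w - ((-(x - 1) : ℝ) : ℂ) + 1 = w + x := by push_cast; ring
  have e2 : ((-(x - 1) : ℝ) : ℂ) - 1 = (-x : ℝ) := by push_cast; ring
  rw [norm_mul, norm_mul, norm_real, e1, e2, norm_neg, Real.norm_of_nonneg (by linarith)] at h
  have h1 : x + w.re ≤ ‖w + x‖ := by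
    have := re_le_norm (w + x)
    simp at this
    linarith
  have hpos : 0 < x + w.re := by linarith
  have h2 : (x - 1) ≤ (1 - c / x) * (x + w.re) := by
    have : (1 - c / x) * (x + w.re) = (x - c) * (x + w.re) / x := by field_simp
    rw [this, le_div_iff₀ hxp]
    nlinarith
  have h3 : (x + w.re) * ‖cbinom w (-x : ℝ)‖ ≤
      (x + w.re) * ((1 - c / x) * ‖cbinom w (-(x - 1) : ℝ)‖) := by
    calc _ ≤ ‖w + x‖ * ‖cbinom w (-x : ℝ)‖ := by gcongr
      _ = ‖cbinom w (-(x - 1) : ℝ)‖ * (x - 1) := h.symm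
      _ ≤ ‖cbinom w (-(x - 1) : ℝ)‖ * ((1 - c / x) * (x + w.re)) := by gcongr
      _ = _ := by ring
  exact le_of_mul_le_mul_left h3 hpos

lemma exists_norm_cbinom_le {w : ℂ} (hw : -1 < w.re) :
    ∃ c K : ℝ, 0 < c ∧ 0 ≤ K ∧ ∀ x : ℝ, ‖cbinom w x‖ ≤ K * (1 + |x|) ^ (-c) := by
  obtain ⟨c, hc0, hc⟩ := exists_between (show 0 < min 1 (w.re + 1) from
    lt_min one_pos (by linarith))
  have hc1 : c ≤ 1 := hc.le.trans (min_le_left _ _)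
  have hcw : c < w.re + 1 := hc.trans_le (min_le_right _ _)
  have hcont : Continuous fun x : ℝ ↦ ‖cbinom w x‖ :=
    ((continuous_cbinom w).comp continuous_ofReal).norm
  obtain ⟨R₁, hR₁, h₁⟩ := norm_cbinom_le_step hc0 hcw
  obtain ⟨R₂, hR₂, h₂⟩ := norm_cbinom_neg_le_step hc0 hcw
  obtain ⟨K₁, hK₁, h₁⟩ := exists_forall_mul_rpow_le hcont (fun _ ↦ norm_nonneg _) hc0 hc1 hR₁ h₁
  obtain ⟨K₂, hK₂, h₂⟩ := exists_forall_mul_rpow_le (g := fun x : ℝ ↦ ‖cbinom w (-x : ℝ)‖)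
    (hcont.comp continuous_neg) (fun _ ↦ norm_nonneg _) hc0 hc1 hR₂ h₂
  refine ⟨c, max K₁ K₂, hc0, le_max_of_le_left hK₁, fun x ↦ ?_⟩
  rw [Real.rpow_neg (by positivity), ← div_eq_mul_inv, le_div_iff₀ (by positivity)]
  rcases le_total 0 x with hx | hx
  · rw [abs_of_nonneg hx]
    exact (h₁ x hx).trans (le_max_left _ _)
  · rw [abs_of_nonpos hx]
    have := h₂ (-x) (by linarith)
    simp only [neg_neg] at this
    exact this.trans (le_max_right _ _)

lemma exists_norm_csinc_le (z : ℂ) :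
    ∃ K : ℝ, 0 ≤ K ∧ ∀ x : ℝ, ‖csinc (x - z)‖ ≤ K * (1 + |x|)⁻¹ := by
  set M := Real.exp (π * |z.im|) with hM
  have hMp : 0 < M := Real.exp_pos _
  refine ⟨M * (2 + ‖z‖), by positivity, fun x ↦ ?_⟩
  have hp := Real.pi_pos
  rw [← div_eq_mul_inv, le_div_iff₀ (by positivity)]
  have h1 := norm_csinc_le x z
  have hsub : ‖csinc (x - z)‖ * ‖(x : ℂ) - z‖ ≤ M := by
    rcases eq_or_ne ((x : ℂ) - z) 0 with h0 | h0
    · rw [h0, norm_zero, mul_zero]; exact hMp.le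
    have hsin : ‖Complex.sin (π * (x - z))‖ ≤ M := by
      have e1 := norm_cexp_neg_I_mul_le (x - z) (s := π) ⟨by linarith, le_rfl⟩
      have e2 : ‖cexp (I * (x - z) * π)‖ ≤ M := by
        have := norm_cexp_neg_I_mul_le (-(x - z)) (s := π) ⟨by linarith, le_rfl⟩
        rw [mul_neg, neg_mul, neg_neg] at this
        simpa using this
      have e1' : ‖cexp (-(I * (x - z) * π))‖ ≤ M := by simpa using e1
      rw [Complex.sin, norm_div, norm_mul, norm_I, mul_one, Complex.norm_two,
        div_le_iff₀ two_pos]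
      calc _ ≤ _ := norm_sub_le _ _
        _ = ‖cexp (-(I * (x - z) * π))‖ + ‖cexp (I * (x - z) * π)‖ := by
          congr 3 <;> ring
        _ ≤ _ := by linarith
    rw [csinc, if_neg h0, norm_div, norm_mul, norm_real, Real.norm_of_nonneg hp.le,
      div_mul_eq_mul_div, div_le_iff₀ (by positivity)]
    have h2 : 1 ≤ π := by linarith [Real.pi_gt_three]
    have h3 : 0 ≤ ‖(x : ℂ) - z‖ := norm_nonneg _
    calc _ ≤ M * ‖(x : ℂ) - z‖ := by gcongr
      _ ≤ M * (π * ‖(x : ℂ) - z‖) := by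
        gcongr
        nlinarith
  have hx : |x| ≤ ‖(x : ℂ) - z‖ + ‖z‖ := by
    have := norm_add_le ((x : ℂ) - z) z
    rwa [sub_add_cancel, norm_real] at this
  calc ‖csinc (x - z)‖ * (1 + |x|)
      ≤ ‖csinc (x - z)‖ * (1 + (‖(x : ℂ) - z‖ + ‖z‖)) := by gcongr
    _ = ‖csinc (x - z)‖ * (1 + ‖z‖) + ‖csinc (x - z)‖ * ‖(x : ℂ) - z‖ := by ring
    _ ≤ M * (1 + ‖z‖) + M := by gcongr
    _ = M * (2 + ‖z‖) := by ring

lemma integrable_cbinom_mul_csinc {w : ℂ} (hw : -1 < w.re) (z : ℂ) :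
    Integrable fun x : ℝ ↦ cbinom w x * csinc (x - z) := by
  obtain ⟨c, K, hc, hK, hb⟩ := exists_norm_cbinom_le hw
  obtain ⟨L, hL, hs⟩ := exists_norm_csinc_le z
  have hi : Integrable fun x : ℝ ↦ K * L * (1 + ‖x‖) ^ (-(1 + c)) :=
    (integrable_one_add_norm (by simpa using hc)).const_mul _
  refine hi.mono' ?_ (Eventually.of_forall fun x ↦ ?_)
  · exact ((continuous_cbinom w).comp continuous_ofReal).aestronglyMeasurable.mul
      (measurable_csinc.comp (by fun_prop)).aestronglyMeasurable
  · rw [norm_mul, neg_add, Real.rpow_add (by positivity), Real.rpow_neg_one, Real.norm_eq_abs]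
    calc _ ≤ (K * (1 + |x|) ^ (-c)) * (L * (1 + |x|)⁻¹) :=
          mul_le_mul (hb x) (hs x) (norm_nonneg _) (by positivity)
      _ = _ := by ring

theorem integral_binom_sinc (w : ℂ) (hw : -1 < w.re) (z : ℂ) :
    ∫ x : ℝ, cbinom w (x : ℂ) * csinc ((x : ℂ) - z) = cbinom w z := by
  have hint := integrable_cbinom_mul_csinc hw z
  simp only [cbinom_eq_integral hw] at hint ⊢
  refine integral_fourier_mul_csinc ?_ z hint
  rw [← intervalIntegrable_iff_integrableOn_Ioc_of_le (by linarith [Real.pi_pos])]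
  exact (intervalIntegrable_cosKernel hw (w / 2)).const_mul _
end
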